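/- arXiv:0711.0476 — 4 statements merged into one kernel-verified Lean document; each statement's English description precedes it below -/
import Mathlib

section
/- (Schupp) Let G be a countable group and let p, q ∈ {2, 3, 4, ...} ∪ {∞} with q ≥ 3. Then there exists a simple group S, an injective group homomorphism φ : G → S, and elements x, y ∈ S such that x has order p, y has order q, and S is generated by {x, y}. -/
open Equiv (Perm)
open scoped commutatorElement

theorem exists_simple_of_detector {H : Type} [Group H] (χ : H) (hχ : χ ≠ 1)
    (htop : ∀ N : Subgroup H, N.Normal → χ ∈ N → N = ⊤) :
    ∃ (S : Type) (_ : Group S) (f : H →* S), IsSimpleGroup S ∧ Function.Surjective f ∧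
      f χ ≠ 1 := by
  obtain ⟨N, hN⟩ := zorn_le_nonempty₀ {N : Subgroup H | N.Normal ∧ χ ∉ N} (by
    intro c hc hchain N₀ hN₀
    refine ⟨sSup c, ⟨⟨fun n hn g => ?_⟩, fun h => ?_⟩, fun z hz => le_sSup hz⟩
    · rw [Subgroup.mem_sSup_of_directedOn ⟨N₀, hN₀⟩ hchain.directedOn] at hn ⊢
      obtain ⟨K, hK, hn⟩ := hn
      exact ⟨K, hK, (hc hK).1.conj_mem n hn g⟩
    · rw [Subgroup.mem_sSup_of_directedOn ⟨N₀, hN₀⟩ hchain.directedOn] at h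
      obtain ⟨K, hK, hn⟩ := h
      exact (hc hK).2 hn) ⊥ ⟨inferInstance, fun h => hχ (Subgroup.mem_bot.1 h)⟩
  have hNn : N.Normal := hN.2.prop.1
  have hNχ : χ ∉ N := hN.2.prop.2
  have hmk : (QuotientGroup.mk' N) χ ≠ 1 := fun h => hNχ ((QuotientGroup.eq_one_iff χ).1 h)
  refine ⟨H ⧸ N, inferInstance, QuotientGroup.mk' N, ?_, QuotientGroup.mk'_surjective N, hmk⟩
  refine { exists_pair_ne := ⟨_, _, hmk⟩, eq_bot_or_eq_top_of_normal := fun K hK => ?_ }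
  have hcn : (K.comap (QuotientGroup.mk' N)).Normal := inferInstance
  have hle : N ≤ K.comap (QuotientGroup.mk' N) := fun n hn => by
    rw [Subgroup.mem_comap, QuotientGroup.mk'_apply, (QuotientGroup.eq_one_iff n).2 hn]
    exact K.one_mem
  by_cases h : χ ∈ K.comap (QuotientGroup.mk' N)
  · right
    have := htop _ hcn h
    rw [eq_top_iff]
    intro z _
    obtain ⟨w, rfl⟩ := QuotientGroup.mk'_surjective N z
    have hw : w ∈ K.comap (QuotientGroup.mk' N) := by rw [this]; trivial
    exact hw
  · left
    have := hN.2.le_of_ge ⟨hcn, h⟩ hle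
    rw [eq_bot_iff]
    intro z hz
    obtain ⟨w, rfl⟩ := QuotientGroup.mk'_surjective N z
    exact (QuotientGroup.eq_one_iff w).2 (this hz)

theorem orderOf_eq_of_pow_ne_one {S : Type} [Group S] {x : S} {p : ℕ} (hp : 0 < p)
    (h1 : x ^ p = 1) (h : ∀ i, 0 < i → i < p → x ^ i ≠ 1) : orderOf x = p :=
  (orderOf_eq_iff hp).2 ⟨h1, fun i hi hi' => h i hi' hi⟩

/-- A group generated by `x` and `y`, with the orders of these divided by `p` and `q`, in which
an element `χ` witnesses that every sufficiently large normal subgroup is everything. -/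
structure TwoGeneratorDetector (G : Type) [Group G] (p q : ℕ) (H : Type) [Group H] where
  x : H
  y : H
  χ : H
  α : G →* H
  closure_eq : Subgroup.closure {x, y} = ⊤
  x_pow : x ^ p = 1
  y_pow : y ^ q = 1
  χ_ne : χ ≠ 1
  eq_top : ∀ N : Subgroup H, N.Normal → χ ∈ N → N = ⊤
  of_x : ∀ N : Subgroup H, N.Normal → ∀ i, 0 < i → i < p → x ^ i ∈ N → χ ∈ N
  of_y : ∀ N : Subgroup H, N.Normal → ∀ i, 0 < i → i < q → y ^ i ∈ N → χ ∈ N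
  of_mul : ∀ N : Subgroup H, N.Normal → ∀ i, 0 < i → (x * y) ^ i ∈ N → χ ∈ N
  of_α : ∀ N : Subgroup H, N.Normal → ∀ g, g ≠ 1 → α g ∈ N → χ ∈ N

theorem TwoGeneratorDetector.exists_simple {G : Type} [Group G] {p q : ℕ} (hp : 0 < p)
    (hq : 0 < q) {H : Type} [Group H] (D : TwoGeneratorDetector G p q H) :
    ∃ (S : Type) (_ : Group S), IsSimpleGroup S ∧ (∃ φ : G →* S, Function.Injective φ) ∧
      ∃ x y : S, orderOf x = p ∧ orderOf y = q ∧ orderOf (x * y) = 0 ∧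
        Subgroup.closure {x, y} = ⊤ := by
  obtain ⟨S, hS, f, hsimple, hf, hfχ⟩ := exists_simple_of_detector D.χ D.χ_ne D.eq_top
  have hker : ∀ g : H, (g ∈ f.ker → D.χ ∈ f.ker) → f g ≠ 1 := fun g h hg => hfχ (h hg)
  refine ⟨S, hS, hsimple, ⟨f.comp D.α, (injective_iff_map_eq_one _).2 fun g hg => ?_⟩,
    f D.x, f D.y, ?_, ?_, ?_, ?_⟩
  · by_contra hne
    exact hker _ (D.of_α f.ker inferInstance g hne) hg
  · refine orderOf_eq_of_pow_ne_one hp (by rw [← map_pow, D.x_pow, map_one]) fun i hi hi' => ?_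
    rw [← map_pow]
    exact hker _ (D.of_x f.ker inferInstance i hi hi')
  · refine orderOf_eq_of_pow_ne_one hq (by rw [← map_pow, D.y_pow, map_one]) fun i hi hi' => ?_
    rw [← map_pow]
    exact hker _ (D.of_y f.ker inferInstance i hi hi')
  · rw [orderOf_eq_zero_iff']
    intro i hi
    rw [← map_mul, ← map_pow]
    exact hker _ (D.of_mul f.ker inferInstance i hi)
  · have := congrArg (Subgroup.map f) D.closure_eq
    rwa [MonoidHom.map_closure, Set.image_pair, ← MonoidHom.range_eq_map,
      MonoidHom.range_eq_top.2 hf] at this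

section Lift

variable {X Y F E : Type}

/-- Permutations of the atoms `F`, acting on `F × E` through the first coordinate. -/
def atomPerm (E : Type) {F : Type} : Perm F →* Perm (F × E) where
  toFun π := π.prodCongr (Equiv.refl E)
  map_one' := rfl
  map_mul' _ _ := rfl

@[simp]
theorem atomPerm_apply (π : Perm F) (c : F) (e : E) : atomPerm E π (c, e) = (π c, e) := rfl

/-- Permutations of a block `Y × E`, acting on `F × E` along an embedding of `Y` in `F`. -/
noncomputable def blockLift (j : Y ↪ F) : Perm (Y × E) →* Perm (F × E) :=
  Perm.viaEmbeddingHom (j.prodMap (Function.Embedding.refl E))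

@[simp]
theorem blockLift_apply (j : Y ↪ F) (s : Perm (Y × E)) (c : Y) (e : E) :
    blockLift j s (j c, e) = (j (s (c, e)).1, (s (c, e)).2) :=
  Perm.viaEmbedding_apply s (j.prodMap (Function.Embedding.refl E)) (c, e)

theorem blockLift_apply_of_notMem (j : Y ↪ F) (s : Perm (Y × E)) {c : F} (e : E)
    (hc : ∀ b, j b ≠ c) : blockLift j s (c, e) = (c, e) :=
  Perm.viaEmbedding_apply_of_notMem s (j.prodMap (Function.Embedding.refl E)) (c, e) (by
    rintro ⟨⟨b, e'⟩, h⟩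
    exact hc b (congrArg Prod.fst h))

theorem blockLift_inv_apply (j : Y ↪ F) (s : Perm (Y × E)) (c : Y) (e : E) :
    (blockLift j s)⁻¹ (j c, e) = (j (s⁻¹ (c, e)).1, (s⁻¹ (c, e)).2) := by
  rw [← map_inv, blockLift_apply]

theorem blockLift_inv_apply_of_notMem (j : Y ↪ F) (s : Perm (Y × E)) {c : F} (e : E)
    (hc : ∀ b, j b ≠ c) : (blockLift j s)⁻¹ (c, e) = (c, e) := by
  rw [← map_inv, blockLift_apply_of_notMem j _ e hc]

theorem blockLift_conj {j j' : Y ↪ F} {g : Perm (F × E)}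
    (hg : ∀ c e, g (j c, e) = (j' c, e)) (s : Perm (Y × E)) :
    g * blockLift j s * g⁻¹ = blockLift j' s := by
  rw [mul_inv_eq_iff_eq_mul]
  ext1 ⟨c, e⟩
  simp only [Perm.mul_apply]
  by_cases hc : ∃ b, j b = c
  · obtain ⟨b, rfl⟩ := hc
    simp [hg]
  · push Not at hc
    rw [blockLift_apply_of_notMem j s e hc]
    obtain ⟨⟨c', e'⟩, hce⟩ : ∃ z, z = g (c, e) := ⟨_, rfl⟩
    rw [← hce, blockLift_apply_of_notMem]
    rintro b rfl
    rw [← hg, g.apply_eq_iff_eq] at hce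
    exact hc b (congrArg Prod.fst hce)

theorem blockLift_commute {j : X ↪ F} {j' : Y ↪ F} (h : ∀ b b', j b ≠ j' b')
    (s : Perm (X × E)) (t : Perm (Y × E)) : Commute (blockLift j s) (blockLift j' t) := by
  refine Perm.Disjoint.commute fun ⟨c, e⟩ => ?_
  by_cases hc : ∃ b, j b = c
  · obtain ⟨b, rfl⟩ := hc
    exact Or.inr (blockLift_apply_of_notMem _ _ _ fun b' hb => h b b' hb.symm)
  · push Not at hc
    exact Or.inl (blockLift_apply_of_notMem _ _ _ hc)

theorem blockLift_blockLift (i : X ↪ Y) (j : Y ↪ F) (s : Perm (X × E)) :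
    blockLift j (blockLift i s) = blockLift (i.trans j) s := by
  ext1 ⟨c, e⟩
  by_cases hc : ∃ b, j b = c
  · obtain ⟨b, rfl⟩ := hc
    by_cases hb : ∃ a, i a = b
    · obtain ⟨a, rfl⟩ := hb
      have := blockLift_apply (i.trans j) s a e
      rw [Function.Embedding.trans_apply] at this
      rw [blockLift_apply, blockLift_apply, this, Function.Embedding.trans_apply]
    · push Not at hb
      rw [blockLift_apply, blockLift_apply_of_notMem _ _ _ hb, blockLift_apply_of_notMem]
      exact fun a ha => hb a (j.injective ha)
  · push Not at hc
    rw [blockLift_apply_of_notMem _ _ _ hc, blockLift_apply_of_notMem _ _ _ fun a => hc (i a)]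

theorem blockLift_atomPerm_swap [DecidableEq Y] [DecidableEq F] (j : Y ↪ F) (a b : Y) :
    blockLift j (atomPerm E (Equiv.swap a b)) = atomPerm E (Equiv.swap (j a) (j b)) := by
  ext1 ⟨c, e⟩
  by_cases hc : ∃ b, j b = c
  · obtain ⟨c, rfl⟩ := hc
    simp [j.injective.map_swap]
  · push Not at hc
    rw [blockLift_apply_of_notMem _ _ _ hc, atomPerm_apply,
      Equiv.swap_apply_of_ne_of_ne (hc a).symm (hc b).symm]

theorem atomPerm_swap_conj [DecidableEq F] {g : Perm (F × E)} {a b a' b' : F}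
    (ha : ∀ e, g (a, e) = (a', e)) (hb : ∀ e, g (b, e) = (b', e)) :
    g * atomPerm E (Equiv.swap a b) * g⁻¹ = atomPerm E (Equiv.swap a' b') := by
  rw [mul_inv_eq_iff_eq_mul]
  ext1 ⟨c, e⟩
  simp only [Perm.mul_apply, atomPerm_apply]
  by_cases hca : c = a
  · subst hca
    simp [ha, hb]
  by_cases hcb : c = b
  · subst hcb
    simp [ha, hb]
  rw [Equiv.swap_apply_of_ne_of_ne hca hcb]
  obtain ⟨⟨c', e'⟩, hce⟩ : ∃ z, z = g (c, e) := ⟨_, rfl⟩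
  rw [← hce, atomPerm_apply, Equiv.swap_apply_of_ne_of_ne]
  · rintro rfl
    rw [← ha, g.apply_eq_iff_eq] at hce
    exact hca (congrArg Prod.fst hce).symm
  · rintro rfl
    rw [← hb, g.apply_eq_iff_eq] at hce
    exact hcb (congrArg Prod.fst hce).symm

end Lift

section Generation

/-- If elements `φ g₁` and `φ g₂` belong to `H` up to commuting factors that centralize the
range of `φ`, then the commutator subgroup of `⟨g₁, g₂⟩` is mapped into `H`. -/
theorem map_commutator_closure_pair_le {K P : Type} [Group K] [Group P] (φ : K →* P)
    (H : Subgroup P) {g₁ g₂ : K} {z₁ z₂ : P} (hz : Commute z₁ z₂)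
    (h₁ : ∀ k, Commute z₁ (φ k)) (h₂ : ∀ k, Commute z₂ (φ k))
    (hg₁ : φ g₁ * z₁ ∈ H) (hg₂ : φ g₂ * z₂ ∈ H) {k : K}
    (hk : k ∈ ⁅Subgroup.closure {g₁, g₂}, Subgroup.closure {g₁, g₂}⁆) : φ k ∈ H := by
  let Z : Subgroup P := Subgroup.closure {z₁, z₂}
  have hZφ : ∀ z ∈ Z, ∀ k, Commute z (φ k) := by
    intro z hz k
    induction hz using Subgroup.closure_induction with
    | mem z hz =>
      rcases hz with rfl | rfl
      exacts [h₁ k, h₂ k]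
    | one => exact Commute.one_left _
    | mul a b _ _ ha hb => exact ha.mul_left hb
    | inv a _ ha => exact ha.inv_left
  have hZ1 : ∀ z ∈ Z, Commute z z₁ ∧ Commute z z₂ := by
    intro z hz'
    induction hz' using Subgroup.closure_induction with
    | mem z hz' =>
      rcases hz' with rfl | rfl
      exacts [⟨Commute.refl _, hz⟩, ⟨hz.symm, Commute.refl _⟩]
    | one => exact ⟨Commute.one_left _, Commute.one_left _⟩
    | mul a b _ _ ha hb => exact ⟨ha.1.mul_left hb.1, ha.2.mul_left hb.2⟩
    | inv a _ ha => exact ⟨ha.1.inv_left, ha.2.inv_left⟩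
  have hZZ : ∀ z ∈ Z, ∀ w ∈ Z, Commute z w := by
    intro z hz w hw
    induction hw using Subgroup.closure_induction with
    | mem w hw =>
      rcases hw with rfl | rfl
      exacts [(hZ1 z hz).1, (hZ1 z hz).2]
    | one => exact Commute.one_right _
    | mul a b _ _ ha hb => exact ha.mul_right hb
    | inv a _ ha => exact ha.inv_right
  have key : ∀ k ∈ Subgroup.closure {g₁, g₂}, ∃ z ∈ Z, φ k * z ∈ H := by
    intro k hk
    induction hk using Subgroup.closure_induction with
    | mem k hk =>
      rcases hk with rfl | rfl
      exacts [⟨z₁, Subgroup.subset_closure (by simp), hg₁⟩,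
        ⟨z₂, Subgroup.subset_closure (by simp), hg₂⟩]
    | one => exact ⟨1, Z.one_mem, by simp⟩
    | mul a b _ _ ha hb =>
      obtain ⟨z, hz, hza⟩ := ha
      obtain ⟨w, hw, hwb⟩ := hb
      refine ⟨z * w, Z.mul_mem hz hw, ?_⟩
      have := H.mul_mem hza hwb
      rwa [mul_assoc, ← mul_assoc z, (hZφ z hz b).eq, mul_assoc, ← mul_assoc, ← map_mul] at this
    | inv a _ ha =>
      obtain ⟨z, hz, hza⟩ := ha
      refine ⟨z⁻¹, Z.inv_mem hz, ?_⟩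
      have := H.inv_mem hza
      rwa [← (hZφ z hz a).eq, mul_inv_rev, ← map_inv] at this
  have hle : ⁅Subgroup.closure {g₁, g₂}, Subgroup.closure {g₁, g₂}⁆ ≤ H.comap φ := by
    rw [Subgroup.commutator_le]
    intro a ha b hb
    obtain ⟨z, hz, hza⟩ := key a ha
    obtain ⟨w, hw, hwb⟩ := key b hb
    have hmem := H.mul_mem (H.mul_mem (H.mul_mem hza hwb) (H.inv_mem hza)) (H.inv_mem hwb)
    have heq : φ a * z * (φ b * w) * (φ a * z)⁻¹ * (φ b * w)⁻¹ = φ ⁅a, b⁆ := by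
      have e1 : φ b * w * z⁻¹ = z⁻¹ * (φ b * w) :=
        (((hZφ z hz b).inv_left.mul_right (hZZ z hz w hw).inv_left).eq).symm
      have e2 : w * (φ a)⁻¹ = (φ a)⁻¹ * w := (hZφ w hw a).inv_right.eq
      calc φ a * z * (φ b * w) * (φ a * z)⁻¹ * (φ b * w)⁻¹
          = φ a * z * (φ b * w * z⁻¹) * (φ a)⁻¹ * (φ b * w)⁻¹ := by group
        _ = φ a * φ b * (w * (φ a)⁻¹) * (φ b * w)⁻¹ := by rw [e1]; group
        _ = φ ⁅a, b⁆ := by rw [e2]; simp only [commutatorElement_def, map_mul, map_inv]; group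
    rw [heq] at hmem
    exact hmem
  exact hle hk

end Generation

section Atoms

/-- The atoms of a line. -/
abbrev LineAtom : Type := ZMod 12 ⊕ (Fin 4 ⊕ Fin 4)

/-- The rows along which lines of different kinds are connected. -/
abbrev ConnRow : Type := (Fin 4 ⊕ Fin 4) ⊕ Bool

/-- The atoms: `q` positions, each with `p` lines and some fillers. -/
abbrev Atom (p q : ℕ) : Type :=
  ZMod q × ((ZMod p × LineAtom) ⊕ Option (ConnRow × {k : ZMod p // k ≠ 0 ∧ k ≠ 1}))

variable {p q : ℕ}

/-- The line number `r` at position `i`. -/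
def line (i : ZMod q) (r : ZMod p) : LineAtom ↪ Atom p q where
  toFun c := (i, Sum.inl (r, c))
  inj' a b h := by simpa using h

theorem line_apply (i : ZMod q) (r : ZMod p) (c : LineAtom) :
    line i r c = ((i, Sum.inl (r, c)) : Atom p q) := rfl

theorem line_ne {i i' : ZMod q} {r r' : ZMod p} (h : i ≠ i' ∨ r ≠ r') (c c' : LineAtom) :
    line i r c ≠ line i' r' c' := by
  simp only [line_apply, ne_eq, Prod.mk.injEq, Sum.inl.injEq]
  tauto

theorem line_injective {i i' : ZMod q} {r r' : ZMod p} {c c' : LineAtom}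
    (h : line i r c = line i' r' c') : i = i' ∧ r = r' ∧ c = c' := by
  simpa only [line_apply, Prod.mk.injEq, Sum.inl.injEq] using h

/-- The first atom of a connecting row, within the shift block of the line `0` at position `2`. -/
def rowSource : ConnRow → ZMod 12
  | Sum.inl (Sum.inl i) => (i : ℕ)
  | Sum.inl (Sum.inr i) => 4 + (i : ℕ)
  | Sum.inr true => 9
  | Sum.inr false => 10

theorem rowSource_injective : Function.Injective rowSource := by decide

theorem rowSource_ne_eight (ρ : ConnRow) : rowSource ρ ≠ 8 := by
  revert ρ; decide

/-- The second atom of a connecting row. -/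
def rowTarget : ConnRow → Atom p q
  | Sum.inl v => line 2 0 (Sum.inr v)
  | Sum.inr true => (0, Sum.inr none)
  | Sum.inr false => (1, Sum.inr none)

/-- The atom number `k` of a connecting row. -/
def rowAtom (k : ZMod p) (ρ : ConnRow) : Atom p q :=
  if h₀ : k = 0 then line 2 0 (Sum.inl (rowSource ρ))
  else if h₁ : k = 1 then rowTarget ρ
  else (2, Sum.inr (some (ρ, ⟨k, h₀, h₁⟩)))

/-- The rows that the first generator rotates. -/
def rotRow : ZMod p × (LineAtom ⊕ LineAtom ⊕ ConnRow) → Atom p q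
  | (k, Sum.inl c) => line 0 k c
  | (k, Sum.inr (Sum.inl c)) => line 1 (-k) c
  | (k, Sum.inr (Sum.inr ρ)) => rowAtom k ρ

theorem zmod_one_ne_zero {n : ℕ} (hn : 2 ≤ n) : (1 : ZMod n) ≠ 0 :=
  have : Fact (1 < n) := ⟨hn⟩
  one_ne_zero

theorem zmod_two_ne_zero {n : ℕ} (hn : 3 ≤ n) : (2 : ZMod n) ≠ 0 := fun h => by
  have := (ZMod.natCast_eq_zero_iff 2 n).1 (by exact_mod_cast h)
  exact absurd (Nat.le_of_dvd two_pos this) (by omega)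

theorem zmod_two_ne_one {n : ℕ} (hn : 3 ≤ n) : (2 : ZMod n) ≠ 1 := fun h => by
  refine zmod_one_ne_zero (n := n) (by omega) ?_
  rw [← one_add_one_eq_two] at h
  simpa using h

theorem rowTarget_injective (hq : 3 ≤ q) :
    Function.Injective (rowTarget : ConnRow → Atom p q) := by
  have h1 := zmod_one_ne_zero (n := q) (by omega)
  rintro (a | _ | _) (b | _ | _) h <;>
    simp_all [rowTarget, line_apply]

theorem rotRow_injective (hp : 2 ≤ p) (hq : 3 ≤ q) :
    Function.Injective (rotRow : _ → Atom p q) := by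
  have h1 := zmod_one_ne_zero (n := q) (by omega)
  have h2 := zmod_two_ne_zero hq
  have h3 := zmod_two_ne_one hq
  have h4 := zmod_one_ne_zero hp
  have hrow : ∀ (k : ZMod p) (ρ : ConnRow) (c : LineAtom) (r : ZMod p) (i : ZMod q), i ≠ 2 →
      rowAtom k ρ ≠ line i r c := by
    rintro k (a | _ | _) c r i hi h <;>
    · unfold rowAtom at h
      split_ifs at h <;> simp_all [rowTarget, line_apply]
      try exact absurd h.1.symm hi
  rintro ⟨k, c | c | ρ⟩ ⟨k', c' | c' | ρ'⟩ h
  · obtain ⟨-, rfl, rfl⟩ := line_injective h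
    rfl
  · exact absurd (line_injective h).1 h1.symm
  · exact absurd h.symm (hrow _ _ _ _ _ h2.symm)
  · exact absurd (line_injective h).1 h1
  · obtain ⟨-, hk, rfl⟩ := line_injective (p := p) (q := q) (i := 1) (i' := 1) h
    rw [neg_inj.1 hk]
  · exact absurd h.symm (hrow _ _ _ _ _ h3.symm)
  · exact absurd h (hrow _ _ _ _ _ h2.symm)
  · exact absurd h (hrow _ _ _ _ _ h3.symm)
  · have h' : rowAtom k ρ = (rowAtom k' ρ' : Atom p q) := h
    suffices k = k' ∧ ρ = ρ' by rw [this.1, this.2]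
    have hT : ∀ ρ σ, line (2 : ZMod q) (0 : ZMod p) (Sum.inl (rowSource ρ)) ≠ rowTarget σ := by
      rintro a (b | _ | _) <;> simp [rowTarget, line_apply]
    have hF : ∀ ρ σ, (rowTarget ρ : Atom p q) ≠ (2, Sum.inr (some σ)) := by
      rintro (b | _ | _) σ <;> simp [rowTarget, line_apply]
    unfold rowAtom at h'
    split_ifs at h' with h5 h6 h7 h8 h9 h10
    · exact ⟨h5.trans h6.symm, rowSource_injective (Sum.inl_injective (line_injective h').2.2)⟩
    · exact absurd h' (hT _ _)
    · simp [line_apply] at h'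
    · exact absurd h'.symm (hT _ _)
    · exact ⟨h8.trans h10.symm, rowTarget_injective hq h'⟩
    · exact absurd h' (hF _ _)
    · simp [line_apply] at h'
    · exact absurd h'.symm (hF _ _)
    · simpa [and_comm] using h'

/-- The rotation of all the rows. -/
noncomputable def rot (hp : 2 ≤ p) (hq : 3 ≤ q) : Perm (Atom p q) :=
  Perm.viaEmbedding ((Equiv.addRight (1 : ZMod p)).prodCongr (Equiv.refl _))
    ⟨rotRow, rotRow_injective hp hq⟩

variable (hp : 2 ≤ p) (hq : 3 ≤ q)

theorem rot_rotRow (k : ZMod p) (z : LineAtom ⊕ LineAtom ⊕ ConnRow) :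
    rot hp hq (rotRow (k, z)) = rotRow (k + 1, z) :=
  Perm.viaEmbedding_apply ((Equiv.addRight (1 : ZMod p)).prodCongr (Equiv.refl _))
    ⟨rotRow, rotRow_injective hp hq⟩ (k, z)

theorem rot_of_notMem {c : Atom p q} (hc : ∀ z, rotRow z ≠ c) : rot hp hq c = c :=
  Perm.viaEmbedding_apply_of_notMem _ ⟨rotRow, rotRow_injective hp hq⟩ c (by
    rintro ⟨z, hz⟩
    exact hc z hz)

theorem rot_line_zero (r : ZMod p) (c : LineAtom) :
    rot hp hq (line 0 r c) = line 0 (r + 1) c :=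
  rot_rotRow hp hq r (Sum.inl c)

theorem rot_line_one (r : ZMod p) (c : LineAtom) :
    rot hp hq (line 1 r c) = line 1 (r - 1) c := by
  have := rot_rotRow hp hq (-r) (Sum.inr (Sum.inl c))
  simpa [rotRow, sub_eq_add_neg, add_comm] using this

theorem rotRow_ne_line (z : ZMod p × (LineAtom ⊕ LineAtom ⊕ ConnRow)) {i : ZMod q} {r : ZMod p}
    {c : LineAtom} (h0 : i ≠ 0) (h1 : i ≠ 1)
    (h : i = 2 → r = 0 → (∃ ρ, c = Sum.inl (rowSource ρ)) ∨ (∃ v, c = Sum.inr v) → False) :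
    rotRow z ≠ line i r c := by
  intro hz
  obtain ⟨k, c' | c' | ρ⟩ := z
  · exact h0 (line_injective hz).1.symm
  · exact h1 (line_injective hz).1.symm
  · change rowAtom k ρ = _ at hz
    unfold rowAtom at hz
    split_ifs at hz
    · obtain ⟨h2, h3, h4⟩ := line_injective hz
      exact h h2.symm h3.symm (Or.inl ⟨ρ, h4.symm⟩)
    · rcases ρ with v | _ | _
      · obtain ⟨h2, h3, h4⟩ := line_injective hz
        exact h h2.symm h3.symm (Or.inr ⟨v, h4.symm⟩)
      · simp [rowTarget, line_apply] at hz
      · simp [rowTarget, line_apply] at hz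
    · simp [line_apply] at hz

theorem rot_line_of_ne_zero {i : ZMod q} {r : ZMod p} (c : LineAtom) (h0 : i ≠ 0) (h1 : i ≠ 1)
    (hr : i ≠ 2 ∨ r ≠ 0) : rot hp hq (line i r c) = line i r c :=
  rot_of_notMem hp hq fun z => rotRow_ne_line z h0 h1 fun h2 h3 _ => by tauto

theorem rot_line_two_eight :
    rot hp hq (line 2 0 (Sum.inl 8)) = line 2 0 (Sum.inl 8) :=
  rot_of_notMem hp hq fun z => rotRow_ne_line z (zmod_two_ne_zero hq) (zmod_two_ne_one hq) (by
    rintro - - (⟨ρ, h⟩ | ⟨v, h⟩)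
    · exact rowSource_ne_eight ρ (Sum.inl_injective h).symm
    · cases h)

theorem rot_rowAtom (k : ZMod p) (ρ : ConnRow) :
    rot hp hq (rowAtom k ρ) = rowAtom (k + 1) ρ :=
  rot_rotRow hp hq k (Sum.inr (Sum.inr ρ))

theorem rowAtom_zero (ρ : ConnRow) :
    (rowAtom 0 ρ : Atom p q) = line 2 0 (Sum.inl (rowSource ρ)) := by
  simp [rowAtom]

include hp in
theorem rowAtom_one (ρ : ConnRow) : (rowAtom 1 ρ : Atom p q) = rowTarget ρ := by
  simp [rowAtom, zmod_one_ne_zero hp]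

theorem rot_line_two (v : Fin 4 ⊕ Fin 4) :
    rot hp hq (line 2 0 (Sum.inl (rowSource (Sum.inl v)))) = line 2 0 (Sum.inr v) := by
  rw [← rowAtom_zero, rot_rowAtom, zero_add, rowAtom_one hp]
  rfl

theorem rot_pow_eq_one : rot hp hq ^ p = 1 := by
  have h : (Equiv.addRight (1 : ZMod p)) ^ p = 1 := by
    ext1 k
    simp
  have h' : ((Equiv.addRight (1 : ZMod p)).prodCongr
      (Equiv.refl (LineAtom ⊕ LineAtom ⊕ ConnRow)) : Perm _) ^ p = 1 := by
    change (atomPerm _ (Equiv.addRight (1 : ZMod p))) ^ p = 1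
    rw [← map_pow, h, map_one]
  change (Perm.viaEmbeddingHom _ _) ^ p = 1
  rw [← map_pow, h', map_one]

/-- The translation of the positions. -/
def posShift (p q : ℕ) : Perm (Atom p q) := (Equiv.addRight (1 : ZMod q)).prodCongr (Equiv.refl _)

@[simp]
theorem posShift_mk (i : ZMod q) (z) : posShift p q (i, z) = (i + 1, z) := rfl

theorem posShift_line (i : ZMod q) (r : ZMod p) (c : LineAtom) :
    posShift p q (line i r c) = line (i + 1) r c := rfl

theorem posShift_pow_apply (n : ℕ) (i : ZMod q) (z) :
    (posShift p q ^ n) (i, z) = (i + n, z) := by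
  induction n with
  | zero => simp
  | succ n ih => rw [pow_succ', Perm.mul_apply, ih, posShift_mk]; push_cast; rw [add_assoc]

theorem posShift_pow_eq_one : posShift p q ^ q = 1 := by
  ext1 ⟨i, z⟩
  simp [posShift_pow_apply]

end Atoms

section Generators

variable {p q : ℕ} {E : Type}

/-- The permutation acting as `s` on a single line. -/
noncomputable def lineLift (s : Perm (LineAtom × E)) (i : ZMod q) (r : ZMod p) :
    Perm (Atom p q × E) :=
  blockLift (line i r) s

/-- All the lines at a position together. -/
def posLines (i : ZMod q) : ZMod p × LineAtom ↪ Atom p q where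
  toFun z := (i, Sum.inl z)
  inj' a b h := by simpa using h

/-- The permutation acting as `s` on each line at a position. -/
noncomputable def posLift (s : Perm (LineAtom × E)) (i : ZMod q) : Perm (Atom p q × E) :=
  blockLift (posLines i) (((Equiv.prodAssoc (ZMod p) LineAtom E).trans
    (Equiv.prodCongrRight fun _ => s)).trans (Equiv.prodAssoc (ZMod p) LineAtom E).symm)

theorem posLift_line (s : Perm (LineAtom × E)) (i : ZMod q) (r : ZMod p) (c : LineAtom) (e : E) :
    posLift s i (line i r c, e) = (line i r (s (c, e)).1, (s (c, e)).2) :=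
  blockLift_apply (posLines i) _ (r, c) e

theorem posLift_of_notMem (s : Perm (LineAtom × E)) {i : ZMod q} {c : Atom p q} (e : E)
    (hc : ∀ r b, line i r b ≠ c) : posLift s i (c, e) = (c, e) :=
  blockLift_apply_of_notMem _ _ _ fun z => hc z.1 z.2

theorem lineLift_commute (s : Perm (LineAtom × E)) (i i' : ZMod q) (r r' : ZMod p) :
    Commute (lineLift s i r) (lineLift s i' r') := by
  by_cases h : i = i' ∧ r = r'
  · rw [h.1, h.2]
  · exact blockLift_commute (line_ne (by tauto)) s s

theorem posShift_conj_lineLift (s : Perm (LineAtom × E)) (i : ZMod q) (r : ZMod p) :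
    atomPerm E (posShift p q) * lineLift s i r * (atomPerm E (posShift p q))⁻¹ =
      lineLift s (i + 1) r :=
  blockLift_conj (fun _ _ => rfl) s

variable (hp : 2 ≤ p) (hq : 3 ≤ q) (s : Perm (LineAtom × E))

/-- The first generator. -/
noncomputable def genX : Perm (Atom p q × E) :=
  lineLift s 1 0 * atomPerm E (rot hp hq) * (lineLift s 1 0)⁻¹

/-- The second generator. -/
def genY (p q : ℕ) (E : Type) : Perm (Atom p q × E) := atomPerm E (posShift p q)

/-- The group generated by the two generators. -/
noncomputable def genGroup : Subgroup (Perm (Atom p q × E)) :=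
  Subgroup.closure {genX hp hq s, genY p q E}

theorem genX_mem : genX hp hq s ∈ genGroup hp hq s := Subgroup.subset_closure (by simp)

theorem genY_mem : genY p q E ∈ genGroup hp hq s := Subgroup.subset_closure (by simp)

theorem genX_pow : genX hp hq s ^ p = 1 := by
  rw [genX, conj_pow, ← map_pow, rot_pow_eq_one, map_one, mul_one, mul_inv_cancel]

theorem genY_pow : genY p q E ^ q = 1 := by
  rw [genY, ← map_pow, posShift_pow_eq_one, map_one]

theorem rot_ne_line_one {c : Atom p q} (hc : ∀ r b, line 1 r b ≠ c) (r : ZMod p) (b : LineAtom) :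
    line 1 r b ≠ rot hp hq c := fun h => by
  refine hc (r + 1) b ((rot hp hq).injective ?_)
  rw [← h, rot_line_one, add_sub_cancel_right]

/-- The first generator moves atoms outside of the lines at position `1` without affecting the
second coordinate. -/
theorem genX_apply {c : Atom p q} (hc : ∀ r b, line 1 r b ≠ c) (e : E) :
    genX hp hq s (c, e) = (rot hp hq c, e) := by
  simp only [genX, Perm.mul_apply, lineLift]
  rw [blockLift_inv_apply_of_notMem _ _ _ (hc 0), atomPerm_apply,
    blockLift_apply_of_notMem _ _ _ (rot_ne_line_one hp hq hc 0)]

theorem genX_line_one_zero (c : LineAtom) (e : E) :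
    genX hp hq s (line 1 0 c, e) = (line 1 (-1) (s⁻¹ (c, e)).1, (s⁻¹ (c, e)).2) := by
  simp only [genX, Perm.mul_apply, lineLift]
  rw [blockLift_inv_apply, atomPerm_apply, rot_line_one, zero_sub, blockLift_apply_of_notMem]
  exact fun b => line_ne (Or.inr (neg_ne_zero.2 (zmod_one_ne_zero hp)).symm) _ _

theorem line_one_ne_line {i : ZMod q} (hi : i ≠ 1) (r : ZMod p) (c : LineAtom) :
    ∀ r' b, line 1 r' b ≠ line i r c := fun _ _ => line_ne (Or.inl hi.symm) _ _

local notation "σ" => rot hp hq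
local notation "τ" => posShift p q

theorem rotConj_line_one (r : ZMod p) (c : LineAtom) :
    (τ * σ * τ⁻¹) (line 1 r c) = line 1 (r + 1) c := by
  have : line (1 : ZMod q) r c = τ (line 0 r c) := by rw [posShift_line, zero_add]
  rw [this, Perm.mul_apply, Perm.mul_apply, show τ⁻¹ (τ (line 0 r c)) = _ from
    Equiv.symm_apply_apply _ _, rot_line_zero, posShift_line,
    zero_add]

theorem rotConj_line_two (r : ZMod p) (c : LineAtom) :
    (τ * σ * τ⁻¹) (line 2 r c) = line 2 (r - 1) c := by
  have : line (2 : ZMod q) r c = τ (line 1 r c) := by rw [posShift_line, one_add_one_eq_two]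
  rw [this, Perm.mul_apply, Perm.mul_apply, show τ⁻¹ (τ (line 1 r c)) = _ from
    Equiv.symm_apply_apply _ _, rot_line_one, posShift_line,
    one_add_one_eq_two]

theorem rot_mul_rotConj_line_one (r : ZMod p) (c : LineAtom) :
    (σ * (τ * σ * τ⁻¹)) (line 1 r c) = line 1 r c := by
  rw [Perm.mul_apply, rotConj_line_one, rot_line_one, add_sub_cancel_right]

theorem commutator_rot_line_one (r : ZMod p) (c : LineAtom) :
    ⁅σ, τ * σ * τ⁻¹⁆ (line 1 r c) = line 1 r c := by
  rw [commutatorElement_def, Perm.mul_apply, Perm.mul_apply]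
  have h1 : (τ * σ * τ⁻¹)⁻¹ (line 1 r c) = line 1 (r - 1) c := by
    rw [Perm.inv_eq_iff_eq, rotConj_line_one, sub_add_cancel]
  have h2 : σ⁻¹ (line 1 (r - 1) c) = line 1 r c := by
    rw [Perm.inv_eq_iff_eq, rot_line_one]
  rw [h1, h2, rot_mul_rotConj_line_one]

theorem posLift_commute_rotConj :
    Commute (posLift s 2) (atomPerm E (τ * σ * τ⁻¹)) := by
  ext1 ⟨c, e⟩
  simp only [Perm.mul_apply _ _ (c, e)]
  rw [atomPerm_apply]
  by_cases hc : ∃ r b, line 2 r b = c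
  · obtain ⟨r, b, rfl⟩ := hc
    rw [rotConj_line_two, posLift_line, posLift_line, atomPerm_apply, rotConj_line_two]
  · push Not at hc
    rw [posLift_of_notMem _ _ hc, atomPerm_apply, posLift_of_notMem]
    intro r b h
    refine hc (r + 1) b ((τ * σ * τ⁻¹).injective ?_)
    rw [← h, rotConj_line_two, add_sub_cancel_right]

theorem posLift_mul_inv_apply {c : Atom p q} (hc : ∀ r b, r ≠ 0 → line 2 r b ≠ c) (e : E) :
    (posLift s 2 * (lineLift s 2 0)⁻¹ : Perm (Atom p q × E)) (c, e) = (c, e) := by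
  rw [Perm.mul_apply, lineLift]
  by_cases hc' : ∃ b, line 2 0 b = c
  · obtain ⟨b, rfl⟩ := hc'
    rw [blockLift_inv_apply, posLift_line]
    simp
  · push Not at hc'
    rw [blockLift_inv_apply_of_notMem _ _ _ hc', posLift_of_notMem]
    intro r b
    by_cases hr : r = 0
    · subst hr; exact hc' b
    · exact hc r b hr

theorem posLift_mul_inv_commute_genX :
    Commute (posLift s 2 * (lineLift s 2 0)⁻¹) (genX hp hq s) := by
  refine Perm.Disjoint.commute fun ⟨c, e⟩ => ?_
  by_cases hc : ∃ r b, r ≠ 0 ∧ line 2 r b = c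
  · obtain ⟨r, b, hr, rfl⟩ := hc
    right
    rw [genX_apply hp hq s (line_one_ne_line (zmod_two_ne_one hq) _ _),
      rot_line_of_ne_zero hp hq _ (zmod_two_ne_zero hq) (zmod_two_ne_one hq) (Or.inr hr)]
  · exact Or.inl (posLift_mul_inv_apply s (fun r b hr h => hc ⟨r, b, hr, h⟩) e)

include hq in
theorem posLift_mul_inv_commute_lineLift (r : ZMod p) :
    Commute (posLift s 2 * (lineLift s 2 0)⁻¹) (lineLift s (1 : ZMod q) r) := by
  refine Perm.Disjoint.commute fun ⟨c, e⟩ => ?_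
  by_cases hc : ∃ b, line 1 r b = c
  · obtain ⟨b, rfl⟩ := hc
    exact Or.inl (posLift_mul_inv_apply s
      (fun r' b' _ => line_ne (Or.inl (zmod_two_ne_one hq)) _ _) e)
  · push Not at hc
    exact Or.inr (blockLift_apply_of_notMem _ _ _ hc)

theorem genX_conj :
    genY p q E * genX hp hq s * (genY p q E)⁻¹ =
      (posLift s 2 * (lineLift s 2 0)⁻¹)⁻¹ * atomPerm E (τ * σ * τ⁻¹) *
        (posLift s 2 * (lineLift s 2 0)⁻¹) := by
  have h1 := posShift_conj_lineLift (p := p) (q := q) s 1 0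
  rw [one_add_one_eq_two] at h1
  have h2 := posLift_commute_rotConj hp hq s
  calc _ = (genY p q E * lineLift s 1 0 * (genY p q E)⁻¹) *
        (genY p q E * atomPerm E σ * (genY p q E)⁻¹) *
        (genY p q E * lineLift s 1 0 * (genY p q E)⁻¹)⁻¹ := by rw [genX]; group
    _ = lineLift s 2 0 * atomPerm E (τ * σ * τ⁻¹) * (lineLift s 2 0)⁻¹ := by
      rw [genY, h1]; simp only [map_mul, map_inv]
    _ = lineLift s 2 0 * ((posLift s 2)⁻¹ * atomPerm E (τ * σ * τ⁻¹) * posLift s 2) *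
        (lineLift s 2 0)⁻¹ := by
      rw [(h2.inv_left).eq, inv_mul_cancel_right]
    _ = _ := by group

/-- The product of lifts to lines at position `1` obtained from a commutator. -/
noncomputable def lineComm : Perm (Atom p q × E) :=
  lineLift s 1 0 * (lineLift s 1 (-1))⁻¹ * lineLift s 1 0 * (lineLift s 1 1)⁻¹

theorem commutator_genX_rotConj :
    ⁅genX hp hq s, atomPerm E (τ * σ * τ⁻¹)⁆ =
      lineComm s * atomPerm E ⁅σ, τ * σ * τ⁻¹⁆ := by
  have h1 : atomPerm E σ * lineLift s 1 0 * (atomPerm E σ)⁻¹ = lineLift s 1 (-1) :=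
    blockLift_conj (fun c e => by rw [atomPerm_apply, rot_line_one, zero_sub]) s
  have h2 : atomPerm E (τ * σ * τ⁻¹) * lineLift s 1 0 * (atomPerm E (τ * σ * τ⁻¹))⁻¹ =
      lineLift s 1 1 :=
    blockLift_conj (fun c e => by rw [atomPerm_apply, rotConj_line_one, zero_add]) s
  have h3 : atomPerm E (σ * (τ * σ * τ⁻¹)) * lineLift s 1 0 *
      (atomPerm E (σ * (τ * σ * τ⁻¹)))⁻¹ = lineLift s 1 0 :=
    blockLift_conj (fun c e => by rw [atomPerm_apply, rot_mul_rotConj_line_one]) s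
  have h4 : atomPerm E ⁅σ, τ * σ * τ⁻¹⁆ * lineLift s 1 1 *
      (atomPerm E ⁅σ, τ * σ * τ⁻¹⁆)⁻¹ = lineLift s 1 1 :=
    blockLift_conj (fun c e => by rw [atomPerm_apply, commutator_rot_line_one]) s
  rw [mul_inv_eq_iff_eq_mul] at h4
  rw [lineComm, mul_assoc (_ * _) _ (atomPerm E _), ← (show Commute _ _ from h4).inv_right.eq,
    ← h1, ← h2]
  nth_rw 3 [← h3]
  rw [genX]
  generalize τ * σ * τ⁻¹ = σ'
  simp only [commutatorElement_def, map_mul, map_inv]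
  group

theorem atomPerm_commutator_commute_lineLift (r : ZMod p) :
    Commute (atomPerm E ⁅σ, τ * σ * τ⁻¹⁆) (lineLift s 1 r) := by
  have := blockLift_conj (g := atomPerm E ⁅σ, τ * σ * τ⁻¹⁆) (j := line 1 r) (j' := line 1 r)
    (fun c e => by rw [atomPerm_apply, commutator_rot_line_one]) s
  rwa [mul_inv_eq_iff_eq_mul] at this

theorem lineComm_pow_mem {m : ℕ} (hm : ∀ π : Perm (Atom p q), π ^ m = 1) :
    (lineComm s : Perm (Atom p q × E)) ^ m ∈ genGroup hp hq s := by
  set g : Perm (Atom p q × E) := posLift s 2 * (lineLift s 2 0)⁻¹ with hg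
  have hgx : Commute g (genX hp hq s) := posLift_mul_inv_commute_genX hp hq s
  have hgt : ∀ r, Commute g (lineLift s 1 r) := posLift_mul_inv_commute_lineLift hq s
  have hgf : Commute g (lineComm s) :=
    (((hgt _).mul_right (hgt _).inv_right).mul_right (hgt _)).mul_right (hgt _).inv_right
  have hct := atomPerm_commutator_commute_lineLift hp hq s
  have hcf : Commute (lineComm s) (atomPerm E ⁅σ, τ * σ * τ⁻¹⁆) :=
    ((((hct _).mul_right (hct _).inv_right).mul_right (hct _)).mul_right (hct _).inv_right).symm
  have key : ⁅genX hp hq s, genY p q E * genX hp hq s * (genY p q E)⁻¹⁆ =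
      g⁻¹ * (lineComm s * atomPerm E ⁅σ, τ * σ * τ⁻¹⁆) * g := by
    rw [genX_conj, ← commutator_genX_rotConj]
    simp only [commutatorElement_def]
    have e1 : genX hp hq s = g⁻¹ * genX hp hq s * g := by
      rw [hgx.inv_left.eq, inv_mul_cancel_right]
    rw [← hg]
    nth_rw 1 2 [e1]
    group
  have hmem : ⁅genX hp hq s, genY p q E * genX hp hq s * (genY p q E)⁻¹⁆ ^ m ∈
      genGroup hp hq s := by
    refine Subgroup.pow_mem _ ?_ _
    have hx := genX_mem hp hq s
    have hy := genY_mem hp hq s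
    have hx' := mul_mem (mul_mem hy hx) (inv_mem hy)
    rw [commutatorElement_def]
    exact mul_mem (mul_mem (mul_mem hx hx') (inv_mem hx)) (inv_mem hx')
  have hpow : ∀ u : Perm (Atom p q × E), (g⁻¹ * u * g) ^ m = g⁻¹ * u ^ m * g := fun u => by
    simpa using conj_pow (a := g⁻¹) (b := u) (i := m)
  rwa [key, hpow, hcf.mul_pow, ← map_pow, hm, map_one, mul_one,
    (hgf.pow_right m).inv_left.eq, inv_mul_cancel_right] at hmem

end Generators

section Labels

/-- Permutations of blocks that are used to build the generators: `2 * m`-th and `24 * m`-th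
roots of a shift and of two permutations whose commutator subgroup contains a copy of `G`. -/
structure Labels (G : Type) [Group G] (m : ℕ) (E : Type) where
  shiftRoot : Perm (ZMod 12 × E)
  root₁ : Perm (Fin 4 × E)
  root₂ : Perm (Fin 4 × E)
  k₁ : Perm (Fin 4 × E)
  k₂ : Perm (Fin 4 × E)
  h : Perm (Fin 4 × E)
  α : G →* Perm (Fin 4 × E)
  shiftRoot_pow : shiftRoot ^ (2 * m) = atomPerm E (Equiv.addRight 1)
  k₁_mem : k₁ ∈ ⁅Subgroup.closure {root₁ ^ (24 * m), root₂ ^ (24 * m)},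
    Subgroup.closure {root₁ ^ (24 * m), root₂ ^ (24 * m)}⁆
  k₂_mem : k₂ ∈ ⁅Subgroup.closure {root₁ ^ (24 * m), root₂ ^ (24 * m)},
    Subgroup.closure {root₁ ^ (24 * m), root₂ ^ (24 * m)}⁆
  h_mem : h ∈ ⁅Subgroup.closure {root₁ ^ (24 * m), root₂ ^ (24 * m)},
    Subgroup.closure {root₁ ^ (24 * m), root₂ ^ (24 * m)}⁆
  α_mem : ∀ g, α g ∈ ⁅Subgroup.closure {root₁ ^ (24 * m), root₂ ^ (24 * m)},
    Subgroup.closure {root₁ ^ (24 * m), root₂ ^ (24 * m)}⁆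
  k₁_apply : ∀ c e, c ≠ 0 → c ≠ 1 → k₁ (c, e) = (c, e)
  k₂_apply : ∀ c e, c ≠ 0 → c ≠ 1 → k₂ (c, e) = (c, e)
  commutator_eq : ⁅k₁, k₂⁆ = atomPerm E (Equiv.swap 0 1)
  conj_α_apply : ∀ g, g ≠ 1 → ∀ c e, c = 0 ∨ c = 1 →
    ((h⁻¹ * α g * h) (c, e)).1 ≠ 0 ∧ ((h⁻¹ * α g * h) (c, e)).1 ≠ 1
  root₁_pow_apply : ∀ n, 0 < n → ∀ c e, c = 0 ∨ c = 1 →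
    (((root₁ ^ (24 * m)) ^ n) (c, e)).1 ≠ 0 ∧ (((root₁ ^ (24 * m)) ^ n) (c, e)).1 ≠ 1

variable {G : Type} [Group G] {m : ℕ} {E : Type} (Λ : Labels G m E)

/-- The shift block of a line. -/
def shiftBlock : ZMod 12 ↪ LineAtom := ⟨Sum.inl, Sum.inl_injective⟩

/-- The first root block of a line. -/
def rootBlock₁ : Fin 4 ↪ LineAtom := ⟨fun i => Sum.inr (Sum.inl i), fun _ _ h => by simpa using h⟩

/-- The second root block of a line. -/
def rootBlock₂ : Fin 4 ↪ LineAtom := ⟨fun i => Sum.inr (Sum.inr i), fun _ _ h => by simpa using h⟩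

/-- Four consecutive atoms of the shift block. -/
def window (n : ZMod 12) : Fin 4 ↪ LineAtom where
  toFun i := Sum.inl (n + (i : ℕ))
  inj' a b h :=
    (by decide : ∀ a b : Fin 4, ((a : ℕ) : ZMod 12) = (b : ℕ) → a = b) a b
      (add_left_cancel (Sum.inl_injective h))

/-- The permutation that the first generator applies to a line. -/
noncomputable def Labels.line : Perm (LineAtom × E) :=
  blockLift shiftBlock Λ.shiftRoot * blockLift rootBlock₁ Λ.root₁ * blockLift rootBlock₂ Λ.root₂

theorem Labels.line_pow (n : ℕ) : Λ.line ^ n =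
    blockLift shiftBlock (Λ.shiftRoot ^ n) * blockLift rootBlock₁ (Λ.root₁ ^ n) *
      blockLift rootBlock₂ (Λ.root₂ ^ n) := by
  have h1 : Commute (blockLift shiftBlock Λ.shiftRoot) (blockLift rootBlock₁ Λ.root₁) :=
    blockLift_commute (fun _ _ h => by cases h) _ _
  have h2 : Commute (blockLift shiftBlock Λ.shiftRoot) (blockLift rootBlock₂ Λ.root₂) :=
    blockLift_commute (fun _ _ h => by cases h) _ _
  have h3 : Commute (blockLift rootBlock₁ Λ.root₁) (blockLift rootBlock₂ Λ.root₂) :=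
    blockLift_commute (fun _ _ h => by cases h) _ _
  rw [Labels.line, (h2.mul_left h3).mul_pow, h1.mul_pow, map_pow, map_pow, map_pow]

theorem Labels.line_pow_two_mul_apply (n : ZMod 12) (e : E) :
    (Λ.line ^ (2 * m)) (Sum.inl n, e) = (Sum.inl (n + 1), e) := by
  rw [Λ.line_pow, Perm.mul_apply, Perm.mul_apply,
    blockLift_apply_of_notMem rootBlock₂ _ _ (fun b h => by cases h),
    blockLift_apply_of_notMem rootBlock₁ _ _ (fun b h => by cases h), Λ.shiftRoot_pow]
  exact blockLift_apply shiftBlock _ n e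

theorem Labels.shiftRoot_pow_mul : Λ.shiftRoot ^ (24 * m) = 1 := by
  have h : (Equiv.addRight (1 : ZMod 12)) ^ 12 = 1 := by decide
  rw [show 24 * m = 2 * m * 12 by ring, pow_mul, Λ.shiftRoot_pow, ← map_pow, h, map_one]

theorem Labels.line_pow_mul : Λ.line ^ (24 * m) =
    blockLift rootBlock₁ (Λ.root₁ ^ (24 * m)) * blockLift rootBlock₂ (Λ.root₂ ^ (24 * m)) := by
  rw [Λ.line_pow, Λ.shiftRoot_pow_mul, map_one, one_mul]

end Labels

section Translation

variable {p q : ℕ} {E : Type} (hp : 2 ≤ p) (hq : 3 ≤ q) (s : Perm (LineAtom × E))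

/-- The contribution of the lines other than `0` to the translation. -/
noncomputable def sideLift (p q m : ℕ) : Perm (Atom p q × E) :=
  (lineLift s 2 (-1))⁻¹ ^ m * (lineLift s 2 1)⁻¹ ^ m

/-- An element of the group that acts as `s ^ (2 * m)` on the line `0` at position `2`. -/
noncomputable def lineTranslation (p q m : ℕ) : Perm (Atom p q × E) :=
  blockLift (line 2 0) (s ^ (2 * m)) * sideLift s p q m

variable {s} in
theorem sideLift_commute {P : Perm (Atom p q × E)} {m : ℕ}
    (h : ∀ r : ZMod p, r ≠ 0 → Commute (lineLift s 2 r) P) (hp : 2 ≤ p) :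
    Commute (sideLift s p q m) P :=
  ((h _ (neg_ne_zero.2 (zmod_one_ne_zero hp))).inv_left.pow_left m).mul_left
    ((h _ (zmod_one_ne_zero hp)).inv_left.pow_left m)

include hp in
theorem sideLift_commute_blockLift {Y : Type} (m : ℕ) (j : Y ↪ LineAtom) (u : Perm (Y × E)) :
    Commute (sideLift s p q m) (blockLift (j.trans (line 2 0)) u) :=
  sideLift_commute (fun _ hr => blockLift_commute
    (fun b b' => line_ne (Or.inr hr) b (j b')) s u) hp

theorem sideLift_commute_genX (m : ℕ) : Commute (sideLift s p q m) (genX hp hq s) := by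
  refine sideLift_commute (fun r hr => Perm.Disjoint.commute fun ⟨c, e⟩ => ?_) hp
  by_cases hc : ∃ b, line 2 r b = c
  · obtain ⟨b, rfl⟩ := hc
    right
    rw [genX_apply hp hq s (line_one_ne_line (zmod_two_ne_one hq) _ _),
      rot_line_of_ne_zero hp hq _ (zmod_two_ne_zero hq) (zmod_two_ne_one hq) (Or.inr hr)]
  · push Not at hc
    exact Or.inl (blockLift_apply_of_notMem _ _ _ hc)

include hp in
theorem sideLift_apply (m : ℕ) (c : LineAtom) (e : E) :
    sideLift s p q m (line 2 0 c, e) = (line 2 0 c, e) := by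
  have h : ∀ r : ZMod p, r ≠ 0 →
      ((lineLift s 2 r)⁻¹ ^ m : Perm (Atom p q × E)) (line 2 0 c, e) = (line 2 0 c, e) := by
    intro r hr
    rw [lineLift, ← map_inv, ← map_pow, blockLift_apply_of_notMem]
    exact fun b => line_ne (Or.inr hr) _ _
  rw [sideLift, Perm.mul_apply, h _ (zmod_one_ne_zero hp),
    h _ (neg_ne_zero.2 (zmod_one_ne_zero hp))]

theorem lineTranslation_mem {m : ℕ} (hm : ∀ π : Perm (Atom p q), π ^ m = 1) :
    lineTranslation s p q m ∈ genGroup hp hq s := by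
  have hy := genY_mem hp hq s
  have := mul_mem (mul_mem hy (lineComm_pow_mem hp hq s hm)) (inv_mem hy)
  convert this using 1
  have hconj := fun r : ZMod p => posShift_conj_lineLift (q := q) s 1 r
  rw [one_add_one_eq_two] at hconj
  have e1 : genY p q E * lineComm s * (genY p q E)⁻¹ =
      lineLift s 2 0 * (lineLift s 2 (-1))⁻¹ * lineLift s 2 0 * (lineLift s 2 1)⁻¹ := by
    rw [← hconj, ← hconj, ← hconj, lineComm, genY]
    group
  have hc := fun r r' : ZMod p => lineLift_commute s (2 : ZMod q) 2 r r'
  have h1 := hc 0 (-1)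
  have h2 := hc 0 1
  have h3 := hc (-1) 0
  have h4 := hc (-1) 1
  rw [← conj_pow, e1,
    ((h2.mul_left h4.inv_left).mul_left h2 |>.inv_right).mul_pow,
    ((Commute.refl _).mul_left h3.inv_left).mul_pow, h1.inv_right.mul_pow,
    mul_assoc (_ ^ m), ((h3.inv_left.pow_left m).pow_right m).eq, ← mul_assoc, ← pow_add, mul_assoc,
    lineTranslation, map_pow, ← two_mul]
  rfl

include hp in
theorem sideLift_commute_lineTranslation (m : ℕ) :
    Commute (sideLift s p q m) (lineTranslation s p q m) :=
  (sideLift_commute_blockLift (q := q) hp s m (Function.Embedding.refl LineAtom)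
    (s ^ (2 * m))).mul_right (Commute.refl _)

variable {G : Type} [Group G] {m : ℕ} (Λ : Labels G m E)

include hp in
theorem lineTranslation_apply (n : ZMod 12) (e : E) :
    lineTranslation Λ.line p q m (line 2 0 (Sum.inl n), e) =
      (line 2 0 (Sum.inl (n + 1)), e) := by
  rw [lineTranslation, Perm.mul_apply, sideLift_apply hp, blockLift_apply,
    Λ.line_pow_two_mul_apply]

include hp in
theorem lineTranslation_pow_apply (k : ℕ) (n : ZMod 12) (e : E) :
    (lineTranslation Λ.line p q m ^ k) (line 2 0 (Sum.inl n), e) =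
      (line 2 0 (Sum.inl (n + k)), e) := by
  induction k with
  | zero => simp
  | succ k ih =>
    rw [pow_succ', Perm.mul_apply, ih, lineTranslation_apply hp]
    push_cast
    rw [add_assoc]

include hp in
theorem lineTranslation_pow_twelve :
    lineTranslation Λ.line p q m ^ 12 =
      blockLift (rootBlock₁.trans (line 2 0)) (Λ.root₁ ^ (24 * m)) *
        blockLift (rootBlock₂.trans (line 2 0)) (Λ.root₂ ^ (24 * m)) *
          sideLift Λ.line p q m ^ 12 := by
  have hc := sideLift_commute_blockLift (q := q) hp Λ.line m (Function.Embedding.refl LineAtom)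
    (Λ.line ^ (2 * m))
  change Commute _ (blockLift (line 2 0) _) at hc
  rw [lineTranslation, hc.symm.mul_pow, ← map_pow, ← pow_mul, show 2 * m * 12 = 24 * m by ring,
    Λ.line_pow_mul, map_mul, blockLift_blockLift, blockLift_blockLift]

theorem genX_window_zero (i : Fin 4) (e : E) :
    genX hp hq s ((window 0).trans (line 2 0) i, e) = (rootBlock₁.trans (line 2 0) i, e) := by
  rw [Function.Embedding.trans_apply, genX_apply hp hq s
    (line_one_ne_line (zmod_two_ne_one hq) _ _)]
  have := rot_line_two hp hq (Sum.inl i)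
  rw [show window 0 i = Sum.inl (rowSource (Sum.inl (Sum.inl i))) by simp [window, rowSource], this]
  rfl

theorem genX_window_four (i : Fin 4) (e : E) :
    genX hp hq s ((window 4).trans (line 2 0) i, e) = (rootBlock₂.trans (line 2 0) i, e) := by
  rw [Function.Embedding.trans_apply, genX_apply hp hq s
    (line_one_ne_line (zmod_two_ne_one hq) _ _)]
  exact congrArg (·, e) (rot_line_two hp hq (Sum.inr i))

include hp in
theorem lineTranslation_pow_four_window (n : ZMod 12) (i : Fin 4) (e : E) :
    (lineTranslation Λ.line p q m ^ 4) ((window n).trans (line 2 0) i, e) =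
      ((window (n + 4)).trans (line 2 0) i, e) := by
  refine (lineTranslation_pow_apply hp Λ 4 _ e).trans ?_
  rw [add_right_comm]
  rfl

/-- The copy of four atoms on which the elements of `G` act. -/
def mainBlock (p q : ℕ) : Fin 4 ↪ Atom p q := (window 4).trans (line 2 0)

theorem window_ne {n n' : ZMod 12} (h : ∀ i j : Fin 4, n + (i : ℕ) ≠ n' + (j : ℕ)) (i j : Fin 4) :
    (window n).trans (line (2 : ZMod q) (0 : ZMod p)) i ≠ (window n').trans (line 2 0) j := by
  intro hij
  exact h i j (Sum.inl_injective ((line (2 : ZMod q) (0 : ZMod p)).injective hij))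

theorem blockLift_mainBlock_mem (hm : ∀ π : Perm (Atom p q), π ^ m = 1) {k : Perm (Fin 4 × E)}
    (hk : k ∈ ⁅Subgroup.closure {Λ.root₁ ^ (24 * m), Λ.root₂ ^ (24 * m)},
      Subgroup.closure {Λ.root₁ ^ (24 * m), Λ.root₂ ^ (24 * m)}⁆) :
    blockLift (mainBlock p q) k ∈ genGroup hp hq Λ.line := by
  set x := genX hp hq Λ.line
  set T := lineTranslation Λ.line p q m
  set J := sideLift Λ.line p q m ^ 12 with hJ
  set g₁ := Λ.root₁ ^ (24 * m)
  set g₂ := Λ.root₂ ^ (24 * m)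
  let A (n : ZMod 12) : Fin 4 ↪ Atom p q := (window n).trans (line 2 0)
  have hT : T ∈ genGroup hp hq Λ.line := lineTranslation_mem hp hq _ hm
  have hJA : ∀ n u, Commute J (blockLift (A n) u) := fun n u =>
    (sideLift_commute_blockLift hp Λ.line m _ u).pow_left 12
  have hJx : Commute J x := (sideLift_commute_genX hp hq Λ.line m).pow_left 12
  have hJT : Commute J T := (sideLift_commute_lineTranslation hp Λ.line m).pow_left 12
  have hinv : ∀ {j j' : Fin 4 ↪ Atom p q}, (∀ i e, x (j i, e) = (j' i, e)) → ∀ u,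
      x⁻¹ * blockLift j' u * x = blockLift j u := fun {j j'} h u => by
    rw [← blockLift_conj h]; group
  have h04 : x⁻¹ * T ^ 12 * x = blockLift (A 0) g₁ * blockLift (A 4) g₂ * J := by
    rw [← hinv (genX_window_zero hp hq Λ.line), ← hinv (genX_window_four hp hq Λ.line),
      lineTranslation_pow_twelve hp Λ, ← hJ]
    calc _ = x⁻¹ * blockLift (rootBlock₁.trans (line 2 0)) g₁ *
          blockLift (rootBlock₂.trans (line 2 0)) g₂ * (J * x) := by
          simp only [mul_assoc]; rfl
      _ = _ := by rw [hJx.eq]; group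
  have h48 : T ^ 4 * (x⁻¹ * T ^ 12 * x) * (T ^ 4)⁻¹ =
      blockLift (A 4) g₁ * blockLift (A 8) g₂ * J := by
    have e1 := blockLift_conj (lineTranslation_pow_four_window (p := p) (q := q) hp Λ 0) g₁
    have e2 := blockLift_conj (lineTranslation_pow_four_window (p := p) (q := q) hp Λ 4) g₂
    rw [show (0 : ZMod 12) + 4 = 4 by decide] at e1
    rw [show (4 : ZMod 12) + 4 = 8 by decide] at e2
    rw [h04]
    calc _ = T ^ 4 * blockLift (A 0) g₁ * blockLift (A 4) g₂ * (J * (T ^ 4)⁻¹) := by group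
      _ = (T ^ 4 * blockLift (A 0) g₁ * (T ^ 4)⁻¹) * (T ^ 4 * blockLift (A 4) g₂ * (T ^ 4)⁻¹) *
          J := by rw [(hJT.pow_right 4).inv_right.eq]; group
      _ = _ := by rw [e1, e2]
  have hx := genX_mem hp hq Λ.line
  have m04 := mul_mem (mul_mem (inv_mem hx) (pow_mem hT 12)) hx
  have m48 := mul_mem (mul_mem (pow_mem hT 4) m04) (inv_mem (pow_mem hT 4))
  rw [h04] at m04
  rw [h48] at m48
  have c04 : ∀ u v, Commute (blockLift (E := E) (A 0) u) (blockLift (A 4) v) :=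
    blockLift_commute (window_ne (by decide))
  have c84 : ∀ u v, Commute (blockLift (E := E) (A 8) u) (blockLift (A 4) v) :=
    blockLift_commute (window_ne (by decide))
  have c80 : ∀ u v, Commute (blockLift (E := E) (A 8) u) (blockLift (A 0) v) :=
    blockLift_commute (window_ne (by decide))
  refine map_commutator_closure_pair_le (blockLift (mainBlock p q)) (genGroup hp hq Λ.line)
    (z₁ := blockLift (A 8) g₂ * J) (z₂ := blockLift (A 0) g₁ * J) ?_ (fun k => ?_) (fun k => ?_)
    ?_ ?_ hk
  · exact ((c80 _ _).mul_right (hJA 8 _).symm).mul_left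
      ((hJA 0 _).mul_right (Commute.refl _))
  · exact (c84 _ _).mul_left (hJA 4 _)
  · exact (c04 _ _).mul_left (hJA 4 _)
  · rwa [← mul_assoc]
  · rwa [← mul_assoc, (show blockLift (mainBlock p q) g₂ * blockLift (A 0) g₁ =
      blockLift (A 0) g₁ * blockLift (A 4) g₂ from (c04 _ _).symm)]

end Translation

section Normal

variable {p q : ℕ} {E : Type} (hp : 2 ≤ p) (hq : 3 ≤ q)

noncomputable instance Atom.decidableEq : DecidableEq (Atom p q) := Classical.decEq _

theorem rowAtom_ne_line_one (hq : 3 ≤ q) (k : ZMod p) (ρ : ConnRow) (r : ZMod p) (c : LineAtom) :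
    line (1 : ZMod q) r c ≠ rowAtom k ρ := by
  have h := zmod_two_ne_one hq
  rcases ρ with a | _ | _ <;> unfold rowAtom <;> split_ifs <;>
    simp [rowTarget, line_apply, h.symm]

/-- The permutation of the atoms induced by a permutation of the lines. -/
noncomputable def linePerm (π : Perm (ZMod q × ZMod p)) : Perm (Atom p q) :=
  Perm.viaEmbedding (π.prodCongr (Equiv.refl LineAtom))
    ⟨fun z => line z.1.1 z.1.2 z.2, fun ⟨⟨_, _⟩, _⟩ ⟨⟨_, _⟩, _⟩ h => by
      obtain ⟨rfl, rfl, rfl⟩ := line_injective h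
      rfl⟩

theorem linePerm_line (π : Perm (ZMod q × ZMod p)) (i : ZMod q) (r : ZMod p) (c : LineAtom) :
    linePerm π (line i r c) = line (π (i, r)).1 (π (i, r)).2 c :=
  Perm.viaEmbedding_apply (π.prodCongr (Equiv.refl LineAtom))
    ⟨fun z => line z.1.1 z.1.2 z.2, _⟩ ((i, r), c)

theorem linePerm_conj (s : Perm (LineAtom × E)) (π : Perm (ZMod q × ZMod p)) (i : ZMod q)
    (r : ZMod p) : atomPerm E (linePerm π) * lineLift s i r * (atomPerm E (linePerm π))⁻¹ =
      lineLift s (π (i, r)).1 (π (i, r)).2 :=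
  blockLift_conj (fun c e => by rw [atomPerm_apply, linePerm_line]) s

/-- A subgroup of `H` normalized by `H`. -/
def NormalIn {P : Type} [Group P] (M H : Subgroup P) : Prop :=
  M ≤ H ∧ ∀ h ∈ H, ∀ n ∈ M, h * n * h⁻¹ ∈ M

theorem gen_mem_of_forall_atomPerm_mem (s : Perm (LineAtom × E))
    {M : Subgroup (Perm (Atom p q × E))} (hM : NormalIn M (genGroup hp hq s))
    (h : ∀ π, atomPerm E π ∈ M) : genX hp hq s ∈ M ∧ genY p q E ∈ M := by
  refine ⟨?_, h _⟩
  have h1 : (1 : ZMod q) ≠ 0 := zmod_one_ne_zero (by omega)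
  have h2 : (1 : ZMod p) ≠ 0 := zmod_one_ne_zero hp
  set σ := atomPerm E (rot hp hq)
  have hx : genX hp hq s = σ * (lineLift s 1 1 * (lineLift s 1 0)⁻¹) := by
    have : σ * lineLift s 1 1 * σ⁻¹ = lineLift s 1 0 :=
      blockLift_conj (fun c e => by rw [atomPerm_apply, rot_line_one, sub_self]) s
    rw [← this, genX]
    change lineLift s 1 0 * σ * (lineLift s 1 0)⁻¹ = _
    rw [← this]
    group
  have he : lineLift s 1 1 * (lineLift s 1 0)⁻¹ ∈ genGroup hp hq s := by
    have := mul_mem (inv_mem (hM.1 (h (rot hp hq)))) (genX_mem hp hq s)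
    rwa [hx, inv_mul_cancel_left] at this
  rw [hx]
  refine mul_mem (h _) ?_
  have c1 := linePerm_conj s (Equiv.swap ((1 : ZMod q), (0 : ZMod p)) (0, 0)) 1 0
  have c2 := linePerm_conj s (Equiv.swap ((1 : ZMod q), (0 : ZMod p)) (0, 0)) 1 1
  have c3 := linePerm_conj s (Equiv.swap ((0 : ZMod q), (0 : ZMod p)) (1, 1)) 0 0
  have c4 := linePerm_conj s (Equiv.swap ((0 : ZMod q), (0 : ZMod p)) (1, 1)) 1 0
  rw [Equiv.swap_apply_left] at c1 c3
  rw [Equiv.swap_apply_of_ne_of_ne (by simp [h2]) (by simp [h1])] at c2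
  rw [Equiv.swap_apply_of_ne_of_ne (by simp [h1]) (by simp [h2.symm])] at c4
  dsimp only at c1 c2 c3 c4
  have m1 : lineLift s 0 0 * (lineLift s 1 0)⁻¹ ∈ M := by
    have hcomm := lineLift_commute s (1 : ZMod q) 0 (1 : ZMod p) 0
    have hcomm' := lineLift_commute s (1 : ZMod q) 1 (1 : ZMod p) 0
    have hc : Commute (lineLift s (1 : ZMod q) (1 : ZMod p))
        ((lineLift s 1 0)⁻¹ * lineLift s 0 0) := hcomm'.inv_right.mul_right hcomm
    have := mul_mem (hM.2 _ he _ (h (linePerm (Equiv.swap ((1 : ZMod q), (0 : ZMod p)) (0, 0)))))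
      (inv_mem (h (linePerm (Equiv.swap ((1 : ZMod q), (0 : ZMod p)) (0, 0)))))
    generalize atomPerm E (linePerm (Equiv.swap ((1 : ZMod q), (0 : ZMod p)) (0, 0))) = g
      at this c1 c2
    convert this using 1
    calc _ = (lineLift s 1 0)⁻¹ * lineLift s 0 0 :=
        (lineLift_commute s (1 : ZMod q) 0 (0 : ZMod p) 0).inv_left.eq.symm
      _ = lineLift s 1 1 * ((lineLift s 1 0)⁻¹ * lineLift s 0 0) * (lineLift s 1 1)⁻¹ := by
        rw [hc.eq, mul_inv_cancel_right]
      _ = lineLift s 1 1 * (lineLift s 1 0)⁻¹ * (g * lineLift s 1 0 * g⁻¹) *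
          (g * lineLift s 1 1 * g⁻¹)⁻¹ := by rw [c1, c2]; group
      _ = _ := by group
  have := hM.2 _ (hM.1 (h (linePerm (Equiv.swap ((0 : ZMod q), (0 : ZMod p)) (1, 1))))) _ m1
  generalize atomPerm E (linePerm (Equiv.swap ((0 : ZMod q), (0 : ZMod p)) (1, 1))) = g
    at this c3 c4
  convert this using 1
  rw [← c3]
  nth_rw 1 [← c4]
  group

variable {G : Type} [Group G] {m : ℕ} (Λ : Labels G m E)

/-- The element that normal subgroups are tested for. -/
noncomputable def testSwap (p q : ℕ) : Perm (Atom p q) := Equiv.swap (mainBlock p q 0) (mainBlock p q 1)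

theorem forall_atomPerm_mem (hm : ∀ π : Perm (Atom p q), π ^ m = 1)
    {M : Subgroup (Perm (Atom p q × E))} (hM : NormalIn M (genGroup hp hq Λ.line))
    (hχ : atomPerm E (testSwap p q) ∈ M) (π : Perm (Atom p q)) : atomPerm E π ∈ M := by
  have : NeZero p := ⟨by omega⟩
  have : NeZero q := ⟨by omega⟩
  set x := genX hp hq Λ.line
  set y := genY p q E with hy
  set T := lineTranslation Λ.line p q m
  have hT : T ∈ genGroup hp hq Λ.line := lineTranslation_mem hp hq _ hm
  have hxm : x ∈ genGroup hp hq Λ.line := genX_mem hp hq _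
  have hym : y ∈ genGroup hp hq Λ.line := genY_mem hp hq _
  let M' : Subgroup (Perm (Atom p q)) := M.comap (atomPerm E)
  have hcarry : ∀ g ∈ genGroup hp hq Λ.line, ∀ {a b a' b'}, (∀ e, g (a, e) = (a', e)) →
      (∀ e, g (b, e) = (b', e)) → Equiv.swap a b ∈ M' → Equiv.swap a' b' ∈ M' := by
    intro g hg a b a' b' ha hb hab
    have := hM.2 g hg _ hab
    rwa [atomPerm_swap_conj ha hb] at this
  have htrans : ∀ {a b c}, Equiv.swap a b ∈ M' → Equiv.swap b c ∈ M' → Equiv.swap a c ∈ M' :=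
    fun h₁ h₂ => SubmonoidClass.swap_mem_trans M' h₁ h₂
  have hsymm : ∀ {a b}, Equiv.swap a b ∈ M' → Equiv.swap b a ∈ M' := fun h => by
    rwa [Equiv.swap_comm]
  let A : ZMod 12 → Atom p q := fun n => line 2 0 (Sum.inl n)
  have hA1 : ∀ k : ℕ, Equiv.swap (A (4 + k)) (A (4 + k + 1)) ∈ M' := by
    intro k
    have h45 : Equiv.swap (A 4) (A 5) ∈ M' := hχ
    refine hcarry (T ^ k) (pow_mem hT k) (fun e => lineTranslation_pow_apply hp Λ k 4 e)
      (fun e => ?_) h45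
    rw [add_right_comm]
    exact lineTranslation_pow_apply hp Λ k 5 e
  have hA2 : ∀ k : ℕ, Equiv.swap (A (4 + k)) (A 4) ∈ M' := by
    intro k
    induction k with
    | zero => simp [M'.one_mem, Perm.one_def.symm]
    | succ k ih =>
      refine htrans (hsymm ?_) ih
      have := hA1 k
      rwa [add_assoc, ← Nat.cast_succ] at this
  have hA : ∀ n, Equiv.swap (A n) (A 8) ∈ M' := by
    intro n
    have h1 := hA2 (n - 4).val
    have h2 := hA2 4
    rw [ZMod.natCast_zmod_val, add_sub_cancel] at h1
    exact htrans h1 (hsymm h2)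
  have hx8 : ∀ e, x (A 8, e) = (A 8, e) := fun e => by
    have := genX_apply hp hq Λ.line (line_one_ne_line (zmod_two_ne_one hq) 0 (Sum.inl 8)) e
    rwa [rot_line_two_eight] at this
  have hrow : ∀ k ρ, Equiv.swap (rowAtom k ρ) (A 8) ∈ M' := by
    intro k ρ
    rw [← ZMod.natCast_zmod_val k]
    induction k.val with
    | zero => rw [Nat.cast_zero, rowAtom_zero]; exact hA _
    | succ n ih =>
      refine hcarry x hxm (fun e => ?_) hx8 ih
      rw [genX_apply hp hq _ (rowAtom_ne_line_one hq _ _), rot_rowAtom, Nat.cast_succ]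
  have hn0 := hrow 1 (Sum.inr true)
  have hn1 := hrow 1 (Sum.inr false)
  rw [rowAtom_one hp] at hn0 hn1
  have hτ : Equiv.swap (posShift p q (A 8)) (A 8) ∈ M' := by
    have := hcarry y hym (fun e => rfl) (fun e => rfl) hn0
    simp only [rowTarget, posShift_mk, zero_add] at this
    exact htrans (hsymm this) hn1
  have hshift : ∀ i z, Equiv.swap (i, z) (A 8) ∈ M' → ∀ k : ℕ,
      Equiv.swap (i + k, z) (A 8) ∈ M' := by
    intro i z h k
    induction k with
    | zero => simpa using h
    | succ k ih =>
      refine htrans (hcarry y hym (a' := (i + (k + 1 : ℕ), z)) (fun e => ?_) (fun e => rfl) ih) hτ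
      rw [hy, genY, atomPerm_apply, posShift_mk, Nat.cast_succ, add_assoc]
  have hpos : ∀ i j z, Equiv.swap (i, z) (A 8) ∈ M' → Equiv.swap (j, z) (A 8) ∈ M' := by
    intro i j z h
    have := hshift i z h (j - i).val
    rwa [ZMod.natCast_zmod_val, add_sub_cancel] at this
  have hline : ∀ r c, Equiv.swap (line 0 r c) (A 8) ∈ M' := by
    intro r c
    rw [← ZMod.natCast_zmod_val r]
    induction r.val with
    | zero =>
      rw [Nat.cast_zero]
      refine hpos 2 0 _ ?_
      rcases c with n | v
      · exact hA n
      · have := hrow 1 (Sum.inl v)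
        rwa [rowAtom_one hp] at this
    | succ n ih =>
      refine hcarry x hxm (fun e => ?_) hx8 ih
      rw [genX_apply hp hq _ (line_one_ne_line (zmod_one_ne_zero (by omega)).symm _ _),
        rot_line_zero, Nat.cast_succ]
  have hall : ∀ c, Equiv.swap c (A 8) ∈ M' := by
    rintro ⟨i, ⟨r, c⟩ | _ | ⟨ρ, k, h₀, h₁⟩⟩
    · exact hpos 0 i _ (hline r c)
    · exact hpos 0 i _ hn0
    · have := hrow k ρ
      rw [rowAtom, dif_neg h₀, dif_neg h₁] at this
      exact hpos 2 i _ this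
  suffices M' = ⊤ from (this ▸ Subgroup.mem_top π : π ∈ M')
  rw [eq_top_iff, ← Perm.closure_isSwap, Subgroup.closure_le]
  rintro _ ⟨a, b, -, rfl⟩
  exact htrans (hall a) (hsymm (hall b))

/-- A permutation moving the first two atoms of the main block outside of them. -/
def Displaces (g : Perm (Atom p q × E)) : Prop :=
  ∀ c e b, (c = 0 ∨ c = 1) → (b = 0 ∨ b = 1) → (g (mainBlock p q c, e)).1 ≠ mainBlock p q b

theorem atomPerm_testSwap_mem_of_displaces (hm : ∀ π : Perm (Atom p q), π ^ m = 1)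
    {M : Subgroup (Perm (Atom p q × E))} (hM : NormalIn M (genGroup hp hq Λ.line))
    {g : Perm (Atom p q × E)} (hg : g ∈ M) (hd : Displaces g) :
    atomPerm E (testSwap p q) ∈ M := by
  have hK₁ := blockLift_mainBlock_mem hp hq Λ hm Λ.k₁_mem
  have hK₂ := blockLift_mainBlock_mem hp hq Λ hm Λ.k₂_mem
  have hfix : ∀ k : Perm (Fin 4 × E), (∀ c e, c ≠ 0 → c ≠ 1 → k (c, e) = (c, e)) →
      ∀ ω : Atom p q × E, ω.1 ≠ mainBlock p q 0 → ω.1 ≠ mainBlock p q 1 →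
        blockLift (mainBlock p q) k ω = ω := by
    rintro k hk ⟨c, e⟩ h0 h1
    by_cases hc : ∃ b, mainBlock p q b = c
    · obtain ⟨b, rfl⟩ := hc
      rw [blockLift_apply, hk b e (fun h => h0 (h ▸ rfl)) (fun h => h1 (h ▸ rfl))]
    · push Not at hc
      exact blockLift_apply_of_notMem _ _ _ hc
  have hcomm : ∀ k : Perm (Fin 4 × E), (∀ c e, c ≠ 0 → c ≠ 1 → k (c, e) = (c, e)) →
      Commute (g * blockLift (mainBlock p q) Λ.k₁ * g⁻¹) (blockLift (mainBlock p q) k) := by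
    intro k hk
    refine Perm.Disjoint.commute fun ω => ?_
    obtain ⟨⟨c, e⟩, rfl⟩ := g.surjective ω
    by_cases hc : c = mainBlock p q 0 ∨ c = mainBlock p q 1
    · right
      rcases hc with rfl | rfl
      · exact hfix k hk _ (hd 0 e 0 (by simp) (by simp)) (hd 0 e 1 (by simp) (by simp))
      · exact hfix k hk _ (hd 1 e 0 (by simp) (by simp)) (hd 1 e 1 (by simp) (by simp))
    · left
      rw [not_or] at hc
      rw [Perm.mul_apply, Perm.mul_apply, show g⁻¹ (g (c, e)) = (c, e) from
        g.symm_apply_apply _, hfix _ Λ.k₁_apply _ hc.1 hc.2]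
  have c1 := hcomm _ Λ.k₁_apply
  have c2 := hcomm _ Λ.k₂_apply
  have hχ : atomPerm E (testSwap p q) =
      ⁅blockLift (mainBlock p q) Λ.k₁, blockLift (mainBlock p q) Λ.k₂⁆ := by
    rw [← map_commutatorElement, Λ.commutator_eq, blockLift_atomPerm_swap, testSwap]
  rw [hχ]
  set K₁ := blockLift (mainBlock p q) Λ.k₁
  set K₂ := blockLift (mainBlock p q) Λ.k₂
  set W := g * K₁ * g⁻¹ with hW
  have m1 : W⁻¹ * K₁ ∈ M := by
    have := mul_mem hg (hM.2 _ (inv_mem hK₁) _ (inv_mem hg))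
    convert this using 1
    rw [hW]
    group
  have m2 := mul_mem m1 (hM.2 _ hK₂ _ (inv_mem m1))
  convert m2 using 1
  have e1 : Commute W⁻¹ ⁅K₁, K₂⁆ :=
    ((c1.mul_right c2).mul_right c1.inv_right).mul_right c2.inv_right |>.inv_left
  calc ⁅K₁, K₂⁆ = W⁻¹ * ⁅K₁, K₂⁆ * W := by rw [e1.eq, inv_mul_cancel_right]
    _ = W⁻¹ * K₁ * K₂ * K₁⁻¹ * (K₂⁻¹ * W) := by rw [commutatorElement_def]; group
    _ = _ := by rw [← c2.inv_right.eq]; group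

theorem genY_pow_displaces {j : ℕ} (hj : 0 < j) (hjq : j < q) :
    Displaces (genY p q E ^ j) := by
  intro c e b _ _ h
  rw [genY, ← map_pow, atomPerm_apply] at h
  have h' := congrArg Prod.fst h
  simp only [mainBlock, Function.Embedding.trans_apply, line_apply, posShift_pow_apply,
    add_eq_left] at h'
  rw [ZMod.natCast_eq_zero_iff] at h'
  exact absurd (Nat.le_of_dvd hj h') (by omega)

end Normal

section Detector

variable {p q : ℕ} {E : Type} (hp : 2 ≤ p) (hq : 3 ≤ q)

theorem genX_pow_line_zero (s : Perm (LineAtom × E)) (k : ℕ) (r : ZMod p) (c : LineAtom) (e : E) :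
    (genX hp hq s ^ k) (line 0 r c, e) = (line 0 (r + (k : ZMod p)) c, e) := by
  induction k with
  | zero => simp
  | succ k ih =>
    rw [pow_succ', Perm.mul_apply, ih, genX_apply hp hq _
      (line_one_ne_line (zmod_one_ne_zero (by omega)).symm _ _), rot_line_zero]
    push_cast
    rw [add_assoc]

theorem genY_line (i : ZMod q) (r : ZMod p) (c : LineAtom) (e : E) :
    genY p q E (line i r c, e) = (line (i + 1) r c, e) := rfl

theorem genY_sq_line (r : ZMod p) (c : LineAtom) (e : E) :
    (genY p q E ^ 2) (line 0 r c, e) = (line 2 r c, e) := by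
  rw [pow_two, Perm.mul_apply, genY_line, genY_line, zero_add, one_add_one_eq_two]

theorem genX_pow_displaces (s : Perm (LineAtom × E)) {i : ℕ} (hi : 0 < i) (hip : i < p) :
    Displaces (genY p q E ^ 2 * genX hp hq s ^ i * (genY p q E ^ 2)⁻¹) := by
  intro c e b _ _ h
  have h1 : (genY p q E ^ 2)⁻¹ (mainBlock p q c, e) = (line 0 0 (window 4 c), e) := by
    rw [Perm.inv_eq_iff_eq, genY_sq_line]
    rfl
  rw [Perm.mul_apply, Perm.mul_apply, h1, genX_pow_line_zero, genY_sq_line, zero_add] at h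
  have h2 := (line_injective (c' := window 4 b) h).2.1
  rw [ZMod.natCast_eq_zero_iff] at h2
  exact absurd (Nat.le_of_dvd hi h2) (by omega)

theorem zmod_natCast_ne {n a b : ℕ} (hab : a < b) (hb : b < n) : (b : ZMod n) ≠ a := by
  intro h
  rw [ZMod.natCast_eq_natCast_iff] at h
  exact hab.ne (Nat.ModEq.eq_of_lt_of_lt h.symm (by omega) hb)

theorem mul_pow_line_one (s : Perm (LineAtom × E)) (k : ℕ) (hk : k + 2 ≤ q) (c : LineAtom)
    (e : E) : ((genX hp hq s * genY p q E) ^ k) (line 1 (-1) c, e) =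
      (line ((k + 1 : ℕ) : ZMod q) (-1) c, e) := by
  induction k with
  | zero => simp
  | succ k ih =>
    have h0 : ((k + 1 + 1 : ℕ) : ZMod q) ≠ 0 := by
      exact_mod_cast zmod_natCast_ne (a := 0) (b := k + 1 + 1) (by omega) (by omega)
    have h1 : ((k + 1 + 1 : ℕ) : ZMod q) ≠ 1 := by
      exact_mod_cast zmod_natCast_ne (a := 1) (b := k + 1 + 1) (by omega) (by omega)
    rw [pow_succ', Perm.mul_apply, ih (by omega), Perm.mul_apply, genY_line, ← Nat.cast_succ,
      Nat.succ_eq_add_one, genX_apply hp hq _ (line_one_ne_line h1 _ _),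
      rot_line_of_ne_zero hp hq _ h0 h1 (Or.inr (neg_ne_zero.2 (zmod_one_ne_zero hp)))]

theorem mul_pow_line_zero (s : Perm (LineAtom × E)) (c : LineAtom) (e : E) :
    ((genX hp hq s * genY p q E) ^ q) (line 0 0 c, e) =
      (line 0 0 (s⁻¹ (c, e)).1, (s⁻¹ (c, e)).2) := by
  obtain ⟨k, rfl⟩ : ∃ k, q = k + 2 := ⟨q - 2, by omega⟩
  rw [pow_succ, pow_succ', Perm.mul_apply, Perm.mul_apply, Perm.mul_apply _ _ (line 0 0 c, e),
    genY_line, zero_add, genX_line_one_zero, mul_pow_line_one hp hq s k le_rfl, Perm.mul_apply,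
    genY_line, ← Nat.cast_succ, Nat.succ_eq_add_one, show ((k + 1 + 1 : ℕ) : ZMod (k + 2)) = 0 from
    ZMod.natCast_self _, genX_apply hp hq _
      (line_one_ne_line (zmod_one_ne_zero (by omega)).symm _ _), rot_line_zero, neg_add_cancel]

theorem mul_pow_mul_line_zero (s : Perm (LineAtom × E)) (n : ℕ) (c : LineAtom) (e : E) :
    ((genX hp hq s * genY p q E) ^ (q * n))⁻¹ (line 0 0 c, e) =
      (line 0 0 ((s ^ n) (c, e)).1, ((s ^ n) (c, e)).2) := by
  rw [Perm.inv_eq_iff_eq, pow_mul]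
  induction n generalizing c e with
  | zero => simp
  | succ n ih =>
    rw [pow_succ, Perm.mul_apply, pow_succ' s, Perm.mul_apply, mul_pow_line_zero]
    rw [Prod.mk.eta, show s⁻¹ (s ((s ^ n) (c, e))) = (s ^ n) (c, e) from s.symm_apply_apply _]
    exact ih c e

variable {G : Type} [Group G] {m : ℕ} (Λ : Labels G m E)

theorem mul_pow_displaces (hm : ∀ π : Perm (Atom p q), π ^ m = 1) {n : ℕ} (hn : 0 < n) :
    ∃ w ∈ genGroup hp hq Λ.line, Displaces (w⁻¹ *
      ((genX hp hq Λ.line * genY p q E) ^ (q * (24 * m * n)))⁻¹ * w) := by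
  have hx := genX_mem hp hq Λ.line
  have hy := genY_mem hp hq Λ.line
  have hT : lineTranslation Λ.line p q m ∈ genGroup hp hq Λ.line := lineTranslation_mem hp hq _ hm
  refine ⟨(genY p q E ^ 2)⁻¹ * genX hp hq Λ.line * (lineTranslation Λ.line p q m ^ 4)⁻¹,
    mul_mem (mul_mem (inv_mem (pow_mem hy 2)) hx) (inv_mem (pow_mem hT 4)), ?_⟩
  have hw : ∀ c e, ((genY p q E ^ 2)⁻¹ * genX hp hq Λ.line *
      (lineTranslation Λ.line p q m ^ 4)⁻¹) (mainBlock p q c, e) =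
        (line 0 0 (rootBlock₁ c), e) := by
    intro c e
    have h1 : (lineTranslation Λ.line p q m ^ 4)⁻¹ (mainBlock p q c, e) =
        ((window 0).trans (line 2 0) c, e) := by
      rw [Perm.inv_eq_iff_eq, lineTranslation_pow_four_window hp Λ, zero_add]
      rfl
    rw [Perm.mul_apply, h1, Perm.mul_apply, genX_window_zero hp hq Λ.line, Perm.inv_eq_iff_eq,
      genY_sq_line]
    rfl
  generalize (genY p q E ^ 2)⁻¹ * genX hp hq Λ.line *
      (lineTranslation Λ.line p q m ^ 4)⁻¹ = w at hw
  intro c e b hc hb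
  have hroot : ∀ c e, (Λ.line ^ (24 * m * n)) (rootBlock₁ c, e) =
      (rootBlock₁ (((Λ.root₁ ^ (24 * m)) ^ n) (c, e)).1,
        (((Λ.root₁ ^ (24 * m)) ^ n) (c, e)).2) := by
    intro c e
    rw [pow_mul, Λ.line_pow_mul, (blockLift_commute (fun _ _ h => by cases h) _ _ :
      Commute (blockLift rootBlock₁ _) (blockLift rootBlock₂ _)).mul_pow, Perm.mul_apply,
      ← map_pow, ← map_pow, blockLift_apply_of_notMem rootBlock₂ _ _ (fun b h => by cases h),
      blockLift_apply]
  have h2 : (w⁻¹ * ((genX hp hq Λ.line * genY p q E) ^ (q * (24 * m * n)))⁻¹ * w)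
      (mainBlock p q c, e) = (mainBlock p q (((Λ.root₁ ^ (24 * m)) ^ n) (c, e)).1,
        (((Λ.root₁ ^ (24 * m)) ^ n) (c, e)).2) := by
    rw [Perm.mul_apply, Perm.mul_apply, hw, mul_pow_mul_line_zero, hroot, Perm.inv_eq_iff_eq, hw]
  rw [h2]
  intro h3
  have h4 := Λ.root₁_pow_apply n hn c e hc
  have h5 := (mainBlock p q).injective h3
  rcases hb with rfl | rfl
  exacts [h4.1 h5, h4.2 h5]

theorem conj_α_displaces {g : G} (hg : g ≠ 1) :
    Displaces ((blockLift (mainBlock p q) Λ.h)⁻¹ * blockLift (mainBlock p q) (Λ.α g) *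
      blockLift (mainBlock p q) Λ.h) := by
  intro c e b hc hb
  rw [← map_inv, ← map_mul, ← map_mul, blockLift_apply]
  intro h
  have h4 := Λ.conj_α_apply g hg c e hc
  have h5 := (mainBlock p q).injective h
  rcases hb with rfl | rfl
  exacts [h4.1 h5, h4.2 h5]

theorem nonempty_detector [Nonempty E] (hm : ∀ π : Perm (Atom p q), π ^ m = 1) :
    Nonempty (TwoGeneratorDetector G p q (genGroup hp hq Λ.line)) := by
  set H := genGroup hp hq Λ.line with hH
  have hx := genX_mem hp hq Λ.line
  have hy := genY_mem hp hq Λ.line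
  have hα : ∀ g, blockLift (mainBlock p q) (Λ.α g) ∈ H := fun g =>
    blockLift_mainBlock_mem hp hq Λ hm (Λ.α_mem g)
  have hχ : atomPerm E (testSwap p q) ∈ H := by
    have h1 := blockLift_mainBlock_mem hp hq Λ hm Λ.k₁_mem
    have h2 := blockLift_mainBlock_mem hp hq Λ hm Λ.k₂_mem
    rw [testSwap, ← blockLift_atomPerm_swap, ← Λ.commutator_eq, map_commutatorElement]
    exact mul_mem (mul_mem (mul_mem h1 h2) (inv_mem h1)) (inv_mem h2)
  have hnorm : ∀ N : Subgroup H, N.Normal → NormalIn (N.map H.subtype) H := by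
    refine fun N hN => ⟨Subgroup.map_subtype_le N, ?_⟩
    rintro h hh _ ⟨n, hn, rfl⟩
    exact ⟨⟨h, hh⟩ * n * ⟨h, hh⟩⁻¹, hN.conj_mem n hn _, rfl⟩
  have hmem : ∀ (N : Subgroup H) (z : H), z ∈ N ↔ (z : Perm (Atom p q × E)) ∈ N.map H.subtype :=
    fun N z => by simp
  have htest : ∀ N : Subgroup H, N.Normal → ∀ g ∈ N.map H.subtype, ∀ h ∈ H,
      Displaces (h * g * h⁻¹) → (⟨_, hχ⟩ : H) ∈ N := fun N hN g hg h hh hd =>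
    (hmem N _).2 (atomPerm_testSwap_mem_of_displaces hp hq Λ hm (hnorm N hN)
      ((hnorm N hN).2 h hh g hg) hd)
  have hcl : Subgroup.closure {(⟨_, hx⟩ : H), ⟨_, hy⟩} = ⊤ := by
    apply Subgroup.map_injective H.subtype_injective
    rw [MonoidHom.map_closure, ← MonoidHom.range_eq_map, Subgroup.range_subtype, Set.image_pair]
    rfl
  refine ⟨{
    x := ⟨_, hx⟩
    y := ⟨_, hy⟩
    χ := ⟨_, hχ⟩
    α := ((blockLift (mainBlock p q)).comp Λ.α).codRestrict H hα
    closure_eq := hcl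
    x_pow := Subtype.ext (genX_pow hp hq Λ.line)
    y_pow := Subtype.ext genY_pow
    χ_ne := fun h => ?_
    eq_top := fun N hN hmemχ => ?_
    of_x := fun N hN i hi hip hmemx => ?_
    of_y := fun N hN i hi hiq hmemy => ?_
    of_mul := fun N hN n hn hmemxy => ?_
    of_α := fun N hN g hg hmemg => ?_ }⟩
  · obtain ⟨e⟩ := ‹Nonempty E›
    have h1 := congrArg (fun f : Perm (Atom p q × E) => (f (mainBlock p q 0, e)).1)
      (congrArg Subtype.val h)
    simp only [atomPerm_apply, testSwap, Equiv.swap_apply_left] at h1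
    exact absurd ((mainBlock p q).injective h1) (by decide)
  · have := gen_mem_of_forall_atomPerm_mem hp hq Λ.line (hnorm N hN)
      (forall_atomPerm_mem hp hq Λ hm (hnorm N hN) ((hmem N _).1 hmemχ))
    rw [eq_top_iff, ← hcl, Subgroup.closure_le]
    rintro z (rfl | rfl)
    exacts [(hmem N _).2 this.1, (hmem N _).2 this.2]
  · exact htest N hN _ ((hmem N _).1 hmemx) _ (pow_mem hy 2)
      (genX_pow_displaces hp hq Λ.line hi hip)
  · refine htest N hN _ ((hmem N _).1 hmemy) 1 H.one_mem ?_
    rw [one_mul, inv_one, mul_one]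
    exact genY_pow_displaces hi hiq
  · obtain ⟨w, hw, hd⟩ := mul_pow_displaces hp hq Λ hm hn
    have h1 : ((genX hp hq Λ.line * genY p q E) ^ (q * (24 * m * n)))⁻¹ ∈ N.map H.subtype := by
      rw [show q * (24 * m * n) = n * (q * (24 * m)) by ring, pow_mul]
      exact inv_mem (pow_mem ((hmem N _).1 hmemxy) _)
    refine htest N hN _ h1 w⁻¹ (inv_mem hw) ?_
    rwa [inv_inv]
  · have h1 := blockLift_mainBlock_mem hp hq Λ hm Λ.h_mem
    refine htest N hN _ ((hmem N _).1 hmemg) _ (inv_mem h1) ?_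
    rw [inv_inv]
    exact conj_α_displaces Λ hg

end Detector

section Fiberwise

variable {I Y : Type}

/-- Permutations of `I × Y` that preserve the first coordinate. -/
def fiberwise : (I → Perm Y) →* Perm (I × Y) where
  toFun u :=
    { toFun := fun z => (z.1, u z.1 z.2)
      invFun := fun z => (z.1, (u z.1)⁻¹ z.2)
      left_inv := fun z => by simp
      right_inv := fun z => by simp }
  map_one' := rfl
  map_mul' _ _ := rfl

@[simp]
theorem fiberwise_apply (u : I → Perm Y) (i : I) (y : Y) : fiberwise u (i, y) = (i, u i y) := rfl

theorem fiberwise_conj (u : I → Perm Y) (π : Perm I) :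
    (atomPerm Y π)⁻¹ * fiberwise u * atomPerm Y π = fiberwise fun i => u (π i) := by
  rw [mul_assoc, inv_mul_eq_iff_eq_mul]
  ext1 ⟨i, y⟩
  simp

end Fiberwise

section Root

variable {M : ℕ} [NeZero M] {Y : Type}

theorem fiberwise_const_eq_pow (u : Perm Y) :
    (atomPerm Y (Equiv.addRight (1 : ZMod M)) * fiberwise (Pi.mulSingle 0 u)) ^ M =
      fiberwise fun _ => u := by
  set R := atomPerm Y (Equiv.addRight (1 : ZMod M)) * fiberwise (Pi.mulSingle 0 u) with hR
  set D : Perm (ZMod M × Y) := fiberwise fun _ => u with hD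
  have hc : Commute D R := by
    refine Commute.mul_right ?_ ?_
    · ext1 ⟨i, y⟩
      simp [hD]
    · rw [commute_iff_eq, hD, ← map_mul, ← map_mul]
      congr 1
      ext1 i
      by_cases hi : i = 0
      · subst hi
        simp
      · simp [hi]
  have hpow : ∀ n, n < M → ∀ y, (R ^ n) (1, y) = (1 + (n : ZMod M), y) := by
    intro n
    induction n with
    | zero => simp
    | succ n ih =>
      intro hn y
      have h0 : (1 + (n : ZMod M)) ≠ 0 := by
        have h1 : ((n + 1 : ℕ) : ZMod M) ≠ 0 := by
          rw [Ne, ZMod.natCast_eq_zero_iff]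
          exact fun h => absurd (Nat.le_of_dvd n.succ_pos h) (by omega)
        push_cast at h1
        rwa [add_comm]
      rw [pow_succ', Perm.mul_apply, ih (by omega), hR, Perm.mul_apply, fiberwise_apply,
        Pi.mulSingle_eq_of_ne h0]
      simp [add_assoc]
  have hlast : ∀ y, (R ^ M) (1, y) = D (1, y) := by
    intro y
    obtain ⟨k, hk⟩ := Nat.exists_eq_succ_of_ne_zero (NeZero.ne M)
    have h0 : (1 + (k : ZMod M)) = 0 := by
      have h1 : ((k + 1 : ℕ) : ZMod M) = 0 := by rw [← Nat.succ_eq_add_one, ← hk, ZMod.natCast_self]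
      push_cast at h1
      rwa [add_comm]
    have h2 := hpow k (by omega) y
    rw [show R ^ M = R ^ (k + 1) from congrArg (R ^ ·) hk, pow_succ', Perm.mul_apply, h2, h0, hR, Perm.mul_apply, fiberwise_apply,
      Pi.mulSingle_eq_same]
    simp [hD]
  ext1 ⟨j, y⟩
  have hj : (R ^ (j - 1).val) (1, y) = (j, y) := by
    rw [hpow _ (ZMod.val_lt _)]
    simp
  rw [← hj, ← Perm.mul_apply, ← Perm.mul_apply, ((Commute.refl R).pow_pow M _).eq,
    (hc.pow_right _).eq, Perm.mul_apply, Perm.mul_apply, hlast]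

/-- Permutations of `F × B`, acting on `F × (B × C)` trivially in the third coordinate. -/
def inflate (C : Type) {F B : Type} : Perm (F × B) →* Perm (F × (B × C)) where
  toFun s := (Equiv.prodAssoc F B C).permCongr (atomPerm C s)
  map_one' := rfl
  map_mul' _ _ := rfl

@[simp]
theorem inflate_apply {C F B : Type} (s : Perm (F × B)) (c : F) (b : B) (i : C) :
    inflate C s (c, (b, i)) = ((s (c, b)).1, ((s (c, b)).2, i)) := rfl

theorem exists_pow_eq_inflate {F B : Type} (s : Perm (F × B)) :
    ∃ r : Perm (F × (B × ZMod M)), r ^ M = inflate (ZMod M) s := by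
  let e : ZMod M × (F × B) ≃ F × (B × ZMod M) :=
    (Equiv.prodComm _ _).trans (Equiv.prodAssoc F B (ZMod M))
  refine ⟨e.permCongrHom (atomPerm _ (Equiv.addRight 1) * fiberwise (Pi.mulSingle 0 s)), ?_⟩
  rw [← map_pow, fiberwise_const_eq_pow]
  rfl

end Root

section Universal

variable {X : Type}

theorem two_pow_add_two_pow_eq {i j a b : ℕ} (hij : i ≠ j) (h : 2 ^ a + 2 ^ j = 2 ^ b + 2 ^ i) :
    a = i ∧ b = j := by
  wlog hlt : i < j generalizing i j a b
  · exact (this hij.symm h.symm (by omega)).symm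
  have key : b = j := by
    rcases lt_trichotomy b j with hb | hb | hb
    · have h1 := Nat.pow_le_pow_right (n := 2) (by decide) (Nat.succ_le_of_lt hb)
      have h2 := Nat.pow_le_pow_right (n := 2) (by decide) (Nat.succ_le_of_lt hlt)
      have h3 := Nat.two_pow_pos a
      rw [Nat.pow_succ] at h1 h2
      omega
    · exact hb
    · have h1 := Nat.pow_lt_pow_right (a := 2) (by decide) hlt
      have h2 := Nat.pow_le_pow_right (n := 2) (by decide) (Nat.succ_le_of_lt hb)
      have h3 := Nat.two_pow_pos i
      rw [Nat.pow_succ] at h2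
      rcases le_or_gt b a with hab | hab
      · have h4 := Nat.pow_le_pow_right (n := 2) (by decide) hab
        omega
      · have h4 := Nat.pow_le_pow_right (n := 2) (by decide) (Nat.succ_le_of_lt hab)
        rw [Nat.pow_succ] at h4
        omega
  subst key
  exact ⟨Nat.pow_right_injective le_rfl (by simpa [add_comm] using h), rfl⟩

theorem addRight_one_pow (n : ℕ) : Equiv.addRight (1 : ℤ) ^ n = Equiv.addRight (n : ℤ) := by
  induction n with
  | zero => ext; simp
  | succ n ih =>
    ext1 k
    simp [pow_succ', ih, add_assoc]

/-- The labels `L i`, placed at the points `2 ^ i`. -/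
noncomputable def sparse {K : Type} [Group K] (L : ℕ → K) : ℤ → K :=
  Function.extend (fun i : ℕ => (2 : ℤ) ^ i) L 1

theorem sparse_pow {K : Type} [Group K] (L : ℕ → K) (i : ℕ) : sparse L (2 ^ i) = L i :=
  Function.Injective.extend_apply (fun _ _ h => Int.pow_right_injective (by decide) h) L 1 i

theorem commutator_sparse {K : Type} [Group K] (L : ℕ → K) {i j : ℕ} (hij : i ≠ j) :
    ⁅fun n : ℤ => sparse L (n + 2 ^ i), fun n : ℤ => sparse L (n + 2 ^ j)⁆ =
      Pi.mulSingle 0 ⁅L i, L j⁆ := by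
  ext1 n
  by_cases hn : n = 0
  · subst hn
    simp [commutatorElement_def, sparse_pow]
  rw [Pi.mulSingle_eq_of_ne hn]
  by_cases ha : ∃ a : ℕ, (2 : ℤ) ^ a = n + 2 ^ i
  · by_cases hb : ∃ b : ℕ, (2 : ℤ) ^ b = n + 2 ^ j
    · obtain ⟨a, ha⟩ := ha
      obtain ⟨b, hb⟩ := hb
      have h : (2 : ℤ) ^ a + 2 ^ j = 2 ^ b + 2 ^ i := by linarith
      obtain ⟨rfl, -⟩ := two_pow_add_two_pow_eq hij (by exact_mod_cast h)
      exact absurd (by linarith) hn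
    · have : sparse L (n + 2 ^ j) = 1 := Function.extend_apply' _ _ _ hb
      simp [commutatorElement_def, this]
  · have : sparse L (n + 2 ^ i) = 1 := Function.extend_apply' _ _ _ ha
    simp [commutatorElement_def, this]

/-- The permutation of `ℤ × X` that acts as `f` on the nonnegative half. -/
def halfPerm (f : Perm X) : Perm (ℤ × X) := fiberwise fun n => if 0 ≤ n then f else 1

theorem commutator_halfPerm (f : Perm X) :
    ⁅halfPerm f, atomPerm X (Equiv.addRight (1 : ℤ))⁆ = fiberwise (Pi.mulSingle 0 f) := by
  rw [commutatorElement_def, mul_inv_eq_iff_eq_mul, mul_inv_eq_iff_eq_mul]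
  ext1 ⟨n, x⟩
  rcases lt_trichotomy n (-1) with h | rfl | h
  · simp [halfPerm, show ¬ 0 ≤ n by omega, show ¬ 0 ≤ n + 1 by omega, show n + 1 ≠ 0 by omega]
  · simp [halfPerm]
  · simp [halfPerm, show 0 ≤ n by omega, show 0 ≤ n + 1 by omega, show n + 1 ≠ 0 by omega]

theorem fiberwise_mulSingle_mem (f : ℕ → Perm X) : ∃ κ : Perm (ℤ × (ℤ × X)), ∀ i,
    fiberwise (Pi.mulSingle 0 (fiberwise (Pi.mulSingle 0 (f i)))) ∈
      ⁅Subgroup.closure {atomPerm (ℤ × X) (Equiv.addRight (1 : ℤ)), κ},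
        Subgroup.closure {atomPerm (ℤ × X) (Equiv.addRight (1 : ℤ)), κ}⁆ := by
  let L : ℕ → Perm (ℤ × X)
    | 0 => atomPerm X (Equiv.addRight (1 : ℤ))
    | i + 1 => halfPerm (f i)
  refine ⟨fiberwise (sparse L), fun i => ?_⟩
  set H := Subgroup.closure {atomPerm (ℤ × X) (Equiv.addRight (1 : ℤ)), fiberwise (sparse L)}
  have hmem : ∀ j : ℕ, fiberwise (fun n : ℤ => sparse L (n + 2 ^ j)) ∈ H := by
    intro j
    have h1 : atomPerm (ℤ × X) (Equiv.addRight ((2 : ℤ) ^ j)) ∈ H := by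
      have := H.pow_mem (Subgroup.subset_closure (Set.mem_insert _ _) :
        atomPerm (ℤ × X) (Equiv.addRight (1 : ℤ)) ∈ H) (2 ^ j)
      rw [← map_pow, addRight_one_pow] at this
      exact_mod_cast this
    have h2 : fiberwise (sparse L) ∈ H := Subgroup.subset_closure (by simp)
    have := mul_mem (mul_mem (inv_mem h1) h2) h1
    rwa [fiberwise_conj] at this
  have := Subgroup.commutator_mem_commutator (hmem (i + 1)) (hmem 0)
  rwa [← map_commutatorElement, commutator_sparse L i.succ_ne_zero, commutator_halfPerm] at this

end Universal

section Prescribed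

variable {E : Type}

/-- Three of the four atoms of a block. -/
def firstThree : Fin 3 ↪ Fin 4 := Fin.castSuccEmb

theorem firstThree_ne (c : Fin 3) : firstThree c ≠ 3 := by revert c; decide

theorem exists_firstThree : ∀ c : Fin 4, c ≠ 3 → ∃ b, firstThree b = c := by decide

/-- Countably many permutations of three infinite atoms lie in the commutator subgroup of a group
generated by two permutations of four atoms. -/
theorem exists_pair_forall_mem_commutator [Countable E] [Infinite E]
    (f : ℕ → Perm (Fin 3 × E)) : ∃ g₁ g₂ : Perm (Fin 4 × E),
      (∀ i, blockLift firstThree (f i) ∈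
        ⁅Subgroup.closure {g₁, g₂}, Subgroup.closure {g₁, g₂}⁆) ∧
      ∀ n, 0 < n → ∀ c e, c ≠ 3 → ((g₁ ^ n) (c, e)).1 = 3 := by
  classical
  obtain ⟨κ, hκ⟩ := fiberwise_mulSingle_mem f
  obtain ⟨t, ht⟩ := exists_injective_nat (ℤ × (ℤ × (Fin 3 × E)))
  let ι : ℤ × (ℤ × (Fin 3 × E)) ↪ Fin 4 × E :=
    { toFun := fun z => if z.1 = 0 ∧ z.2.1 = 0 then (firstThree z.2.2.1, z.2.2.2)
        else (3, Infinite.natEmbedding E (t z))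
      inj' := by
        rintro ⟨a, b, c, e⟩ ⟨a', b', c', e'⟩ h
        simp only at h
        split_ifs at h with h1 h2 h2
        · obtain ⟨rfl, rfl⟩ := h1
          obtain ⟨rfl, rfl⟩ := h2
          obtain ⟨h3, rfl⟩ := Prod.ext_iff.1 h
          rw [firstThree.injective h3]
        · exact absurd (congrArg Prod.fst h) (firstThree_ne c)
        · exact absurd (congrArg Prod.fst h).symm (firstThree_ne c')
        · exact ht ((Infinite.natEmbedding E).injective (congrArg Prod.snd h)) }
  have hι : ∀ c e, ι (0, (0, (c, e))) = (firstThree c, e) := fun c e => rfl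
  have hι' : ∀ z, ¬ (z.1 = 0 ∧ z.2.1 = 0) → (ι z).1 = 3 := fun z hz => by
    change (if _ then _ else _ : Fin 4 × E).1 = 3
    rw [if_neg hz]
  let V := Perm.viaEmbeddingHom ι
  have hV : ∀ s z, V s (ι z) = ι (s z) := fun s z => Perm.viaEmbedding_apply s ι z
  have hV' : ∀ s w, w ∉ Set.range ι → V s w = w := fun s w hw =>
    Perm.viaEmbedding_apply_of_notMem s ι w hw
  refine ⟨V (atomPerm _ (Equiv.addRight 1)), V κ, fun i => ?_, fun n hn c e hc => ?_⟩
  · have h1 := Subgroup.mem_map_of_mem V (hκ i)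
    rw [Subgroup.map_commutator, MonoidHom.map_closure, Set.image_pair] at h1
    convert h1 using 1
    ext1 ⟨c, e⟩
    by_cases hc : ∃ b, firstThree b = c
    · obtain ⟨c, rfl⟩ := hc
      rw [blockLift_apply, ← hι, ← hι, hV]
      simp
    · push Not at hc
      rw [blockLift_apply_of_notMem _ _ _ hc]
      by_cases hr : (c, e) ∈ Set.range ι
      · obtain ⟨⟨a, b, x⟩, hz⟩ := hr
        rw [← hz, hV]
        congr 1
        by_cases ha : a = 0
        · subst ha
          by_cases hb : b = 0
          · subst hb
            exact absurd (congrArg Prod.fst hz) (hc x.1)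
          · simp [hb]
        · simp [ha]
      · rw [hV' _ _ hr]
  · obtain ⟨c, rfl⟩ := exists_firstThree c hc
    rw [← hι, ← map_pow, ← map_pow, addRight_one_pow, hV]
    apply hι'
    simp [hn.ne']

variable (G : Type) [Group G]

/-- The left multiplication of `G` on the middle factor. -/
def mulPerm : G →* Perm (Fin 3 × (Bool × (G × ℕ))) where
  toFun g := (Equiv.refl _).prodCongr ((Equiv.refl _).prodCongr
    ((Equiv.mulLeft g).prodCongr (Equiv.refl _)))
  map_one' := by ext1 ⟨c, b, g, n⟩; simp
  map_mul' g h := by ext1 ⟨c, b, g, n⟩; simp [mul_assoc]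

theorem exists_exchange [Countable G] : ∃ h : Perm (Fin 3 × (Bool × (G × ℕ))),
    ∀ g, g ≠ 1 → ∀ c e, c ≠ 2 → ((h⁻¹ * mulPerm G g * h) (c, e)).1 = 2 := by
  obtain ⟨r, hr⟩ := exists_injective_nat (Fin 3 × (Bool × (G × ℕ)))
  let j : Bool × (Fin 2 × (Bool × (G × ℕ))) ↪ Fin 3 × (Bool × (G × ℕ)) :=
    { toFun := fun z => if z.1 then (z.2.1.castSucc, z.2.2)
        else (2, (false, (1, r (z.2.1.castSucc, z.2.2))))
      inj' := by
        rintro ⟨a, c, e⟩ ⟨a', c', e'⟩ h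
        have h2 : ∀ c : Fin 2, c.castSucc ≠ (2 : Fin 3) := by decide
        cases a <;> cases a'
        · have h3 := hr (congrArg (fun z => z.2.2.2) h)
          obtain ⟨h4, h5⟩ := Prod.mk.inj h3
          rw [show c = c' from Fin.castSucc_injective _ h4, show e = e' from h5]
        · exact absurd (congrArg Prod.fst h).symm (h2 c')
        · exact absurd (congrArg Prod.fst h) (h2 c)
        · obtain ⟨h4, h5⟩ := Prod.mk.inj h
          rw [show c = c' from Fin.castSucc_injective _ h4, show e = e' from h5] }
  refine ⟨Perm.viaEmbedding (Equiv.boolNot.prodCongr (Equiv.refl _)) j, fun g hg c e hc => ?_⟩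
  obtain ⟨c, rfl⟩ := (by decide : ∀ c : Fin 3, c ≠ 2 → ∃ b : Fin 2, b.castSucc = c) c hc
  have h1 : Perm.viaEmbedding (Equiv.boolNot.prodCongr (Equiv.refl _)) j (c.castSucc, e) =
      (2, (false, (1, r (c.castSucc, e)))) :=
    Perm.viaEmbedding_apply (Equiv.boolNot.prodCongr (Equiv.refl _)) j (true, (c, e))
  have h2 : (2, (false, (g, r (c.castSucc, e)))) ∉ Set.range j := by
    rintro ⟨⟨a, c', e'⟩, h⟩
    cases a
    · exact hg (congrArg (fun z => z.2.2.1) h).symm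
    · exact (by decide : ∀ c : Fin 2, c.castSucc ≠ (2 : Fin 3)) c' (congrArg Prod.fst h)
  rw [Perm.mul_apply, Perm.mul_apply, h1]
  have h3 : mulPerm G g (2, (false, (1, r (c.castSucc, e)))) =
      (2, (false, (g, r (c.castSucc, e)))) := by
    simp [mulPerm]
  rw [h3, Perm.inv_eq_iff_eq.2 (Perm.viaEmbedding_apply_of_notMem _ j _ h2).symm]

theorem exists_commutator_eq_swap : ∃ k₁ k₂ : Perm (Fin 3 × Bool),
    (∀ b, k₁ (2, b) = (2, b)) ∧ (∀ b, k₂ (2, b) = (2, b)) ∧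
      ⁅k₁, k₂⁆ = atomPerm Bool (Equiv.swap 0 1) :=
  ⟨Equiv.swap (0, false) (1, false) * Equiv.swap (1, false) (0, true),
    Equiv.swap (0, false) (1, false) * Equiv.swap (1, false) (1, true), by decide, by decide,
    by decide⟩

theorem exists_labels [Countable G] (m : ℕ) (hm : 0 < m) :
    ∃ E : Type, Nonempty E ∧ Nonempty (Labels G m E) := by
  have : NeZero (24 * m) := ⟨by omega⟩
  let E := Bool × (G × ℕ)
  obtain ⟨k₁, k₂, hk₁, hk₂, hk⟩ := exists_commutator_eq_swap
  obtain ⟨h, hh⟩ := exists_exchange G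
  let P : Set (Perm (Fin 3 × E)) :=
    {inflate (G × ℕ) k₁, inflate (G × ℕ) k₂, h} ∪ Set.range (mulPerm G)
  have hP : P.Countable := ((Set.toFinite _).countable).union (Set.countable_range _)
  obtain ⟨f, hf⟩ := hP.exists_eq_range ⟨h, by simp [P]⟩
  obtain ⟨g₁, g₂, hg, hn⟩ := exists_pair_forall_mem_commutator f
  obtain ⟨r, hr⟩ := exists_pow_eq_inflate (M := 24 * m) (atomPerm E (Equiv.addRight (1 : ZMod 12)))
  obtain ⟨r₁, hr₁⟩ := exists_pow_eq_inflate (M := 24 * m) g₁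
  obtain ⟨r₂, hr₂⟩ := exists_pow_eq_inflate (M := 24 * m) g₂
  let Φ : Perm (Fin 3 × E) →* Perm (Fin 4 × (E × ZMod (24 * m))) :=
    (inflate (ZMod (24 * m))).comp (blockLift firstThree)
  have hΦ : ∀ s c e i, Φ s (firstThree c, (e, i)) =
      (firstThree (s (c, e)).1, ((s (c, e)).2, i)) := by
    intro s c e i
    change inflate _ (blockLift firstThree s) _ = _
    rw [inflate_apply, blockLift_apply]
  have hΦ' : ∀ s e, Φ s (3, e) = (3, e) := by
    intro s e
    change inflate _ (blockLift firstThree s) (3, (e.1, e.2)) = _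
    rw [inflate_apply, blockLift_apply_of_notMem _ _ _ firstThree_ne]
  have hmem : ∀ s ∈ P, Φ s ∈ ⁅Subgroup.closure {r₁ ^ (24 * m), r₂ ^ (24 * m)},
      Subgroup.closure {r₁ ^ (24 * m), r₂ ^ (24 * m)}⁆ := by
    intro s hs
    rw [hf] at hs
    obtain ⟨i, rfl⟩ := hs
    have h1 := Subgroup.mem_map_of_mem (inflate (ZMod (24 * m))) (hg i)
    rwa [Subgroup.map_commutator, MonoidHom.map_closure, Set.image_pair, ← hr₁, ← hr₂] at h1
  have hfix : ∀ k : Perm (Fin 3 × Bool), (∀ b, k (2, b) = (2, b)) → ∀ c e, c ≠ 0 → c ≠ 1 →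
      Φ (inflate (G × ℕ) k) (c, e) = (c, e) := by
    rintro k hk c ⟨⟨b, e⟩, i⟩ h0 h1
    rcases (by decide : ∀ c : Fin 4, c ≠ 0 → c ≠ 1 → c = firstThree 2 ∨ c = 3) c h0 h1 with rfl | rfl
    · rw [hΦ, inflate_apply, hk]
    · rw [hΦ']
  have h01 : ∀ c : Fin 4, c = 0 ∨ c = 1 → ∃ b, b ≠ 2 ∧ firstThree b = c := by decide
  refine ⟨E × ZMod (24 * m), inferInstance, ⟨{
    shiftRoot := r ^ 12
    root₁ := r₁
    root₂ := r₂
    k₁ := Φ (inflate (G × ℕ) k₁)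
    k₂ := Φ (inflate (G × ℕ) k₂)
    h := Φ h
    α := Φ.comp (mulPerm G)
    shiftRoot_pow := ?_
    k₁_mem := hmem _ (by simp [P])
    k₂_mem := hmem _ (by simp [P])
    h_mem := hmem _ (by simp [P])
    α_mem := fun g => hmem _ (by simp [P])
    k₁_apply := hfix k₁ hk₁
    k₂_apply := hfix k₂ hk₂
    commutator_eq := ?_
    conj_α_apply := fun g hg c e hc => ?_
    root₁_pow_apply := fun n hn' c e hc => ?_ }⟩⟩
  · rw [← pow_mul, show 12 * (2 * m) = 24 * m by ring, hr]
    rfl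
  · rw [← map_commutatorElement, ← map_commutatorElement, hk]
    exact congrArg (inflate (ZMod (24 * m))) (blockLift_atomPerm_swap firstThree (0 : Fin 3) 1)
  · obtain ⟨b, hb, rfl⟩ := h01 c hc
    obtain ⟨e, i⟩ := e
    have h1 : (Φ h)⁻¹ * Φ.comp (mulPerm G) g * Φ h = Φ (h⁻¹ * mulPerm G g * h) := by
      rw [map_mul, map_mul, map_inv]
      rfl
    refine (by decide : ∀ c : Fin 4, c = firstThree 2 → c ≠ 0 ∧ c ≠ 1) _ ?_
    rw [h1, hΦ, hh g hg b e hb]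
  · obtain ⟨e, i⟩ := e
    rw [hr₁, ← map_pow, inflate_apply, hn n hn' c e (by rcases hc with rfl | rfl <;> decide)]
    decide

end Prescribed

theorem exists_twoGeneratorDetector (G : Type) [Group G] [Countable G] {p q : ℕ} (hp : 2 ≤ p)
    (hq : 3 ≤ q) : ∃ (H : Type) (_ : Group H), Nonempty (TwoGeneratorDetector G p q H) := by
  have : NeZero p := ⟨by omega⟩
  have : NeZero q := ⟨by omega⟩
  have : Finite (Atom p q) := inferInstance
  obtain ⟨E, _, ⟨Λ⟩⟩ := exists_labels G (Nat.card (Perm (Atom p q))) Nat.card_pos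
  exact ⟨_, _, nonempty_detector hp hq Λ fun _ => pow_card_eq_one'⟩

theorem closure_pair_eq_top {S : Type} [Group S] {x y u v : S}
    (h : Subgroup.closure {x, y} = ⊤) (hx : x ∈ Subgroup.closure {u, v})
    (hy : y ∈ Subgroup.closure {u, v}) : Subgroup.closure {u, v} = ⊤ := by
  rw [eq_top_iff, ← h, Subgroup.closure_le]
  rintro z (rfl | rfl)
  exacts [hx, hy]

/-- Corollary S (Schupp): for every countable group `G` and every
`p ∈ {2,3,...} ∪ {∞}`, `q ∈ {3,4,...} ∪ {∞}` (order `0` encodes `∞`), there is a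
simple group `S` containing an isomorphic copy of `G` and generated by a pair of
elements of orders `p` and `q` respectively. -/
theorem schupp_corollary_simple_group_two_generators
    (G : Type) [Group G] [Countable G]
    (p q : ℕ) (hp : p = 0 ∨ 2 ≤ p) (hq : q = 0 ∨ 3 ≤ q) :
    ∃ (S : Type) (_ : Group S), IsSimpleGroup S ∧ (∃ φ : G →* S, Function.Injective φ) ∧
      ∃ x y : S, orderOf x = p ∧ orderOf y = q ∧ Subgroup.closure {x, y} = ⊤ := by
  have key : ∀ p q : ℕ, 2 ≤ p → 3 ≤ q →
      ∃ (S : Type) (_ : Group S), IsSimpleGroup S ∧ (∃ φ : G →* S, Function.Injective φ) ∧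
        ∃ x y : S, orderOf x = p ∧ orderOf y = q ∧ orderOf (x * y) = 0 ∧
          Subgroup.closure {x, y} = ⊤ := fun p q hp hq => by
    obtain ⟨H, _, ⟨D⟩⟩ := exists_twoGeneratorDetector G hp hq
    exact D.exists_simple (by omega) (by omega)
  rcases hp with rfl | hp <;> rcases hq with rfl | hq
  · obtain ⟨S, _, hS, hφ, x, y, hx, hy, hxy, hc⟩ := key 2 3 le_rfl le_rfl
    have h1 : x * y ∈ Subgroup.closure {x * y, y * (x * y)} :=
      Subgroup.subset_closure (by simp)
    have h2 : y * (x * y) ∈ Subgroup.closure {x * y, y * (x * y)} :=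
      Subgroup.subset_closure (by simp)
    have hy' : y ∈ Subgroup.closure {x * y, y * (x * y)} := by
      simpa only [mul_inv_cancel_right] using Subgroup.mul_mem _ h2 (Subgroup.inv_mem _ h1)
    have hx' : x ∈ Subgroup.closure {x * y, y * (x * y)} := by
      simpa using Subgroup.mul_mem _ h1 (Subgroup.inv_mem _ hy')
    refine ⟨S, _, hS, hφ, x * y, y * (x * y), hxy, ?_, closure_pair_eq_top hc hx' hy'⟩
    have hx2 : x * x = 1 := by rw [← pow_two, ← hx, pow_orderOf_eq_one]
    have hy3 : y * y * y = 1 := by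
      have := pow_orderOf_eq_one y
      rwa [hy, pow_succ, pow_two] at this
    have hconj : y * (x * y) = (y * y) * (x * y)⁻¹ * (y * y)⁻¹ := by
      have hxi : x⁻¹ = x := inv_eq_of_mul_eq_one_left hx2
      have hyi : (y * y)⁻¹ = y := inv_eq_of_mul_eq_one_left (by rw [← mul_assoc, hy3])
      rw [hyi, mul_inv_rev, hxi]
      group
    rw [hconj, MulAut.conj_apply _ _ |>.symm, MulEquiv.orderOf_eq, orderOf_inv, hxy]
  · obtain ⟨S, _, hS, hφ, x, y, hx, hy, hxy, hc⟩ := key 2 q le_rfl hq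
    have h1 : x * y ∈ Subgroup.closure {x * y, y} := Subgroup.subset_closure (by simp)
    have h2 : y ∈ Subgroup.closure {x * y, y} := Subgroup.subset_closure (by simp)
    refine ⟨S, _, hS, hφ, x * y, y, hxy, hy, closure_pair_eq_top hc ?_ h2⟩
    simpa using Subgroup.mul_mem _ h1 (Subgroup.inv_mem _ h2)
  · obtain ⟨S, _, hS, hφ, x, y, hx, hy, hxy, hc⟩ := key p 3 hp le_rfl
    have h1 : x * y ∈ Subgroup.closure {x, x * y} := Subgroup.subset_closure (by simp)
    have h2 : x ∈ Subgroup.closure {x, x * y} := Subgroup.subset_closure (by simp)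
    refine ⟨S, _, hS, hφ, x, x * y, hx, hxy, closure_pair_eq_top hc h2 ?_⟩
    simpa using Subgroup.mul_mem _ (Subgroup.inv_mem _ h2) h1
  · obtain ⟨S, _, hS, hφ, x, y, hx, hy, hxy, hc⟩ := key p q hp hq
    exact ⟨S, _, hS, hφ, x, y, hx, hy, hc⟩
end

section
/- (Higman–Neumann–Neumann) Every countable group G can be embedded into a countable group H in which any two elements of the same order are conjugate: there exists a countable group H and an injective group homomorphism φ : G → H such that for all x, y ∈ H with orderOf x = orderOf y, the elements x and y are conjugate in H. -/
open CategoryTheory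

/-- Left multiplication by `x` on `G × ℕ` is a disjoint union of countably many copies of left
multiplication by `x` on the cyclic subgroup generated by `x`. -/
theorem exists_equiv_zpowers_prod_nat {G : Type*} [Group G] [Countable G] (x : G) :
    ∃ e : Subgroup.zpowers x × ℕ ≃ G × ℕ, ∀ (h : Subgroup.zpowers x) (n : ℕ),
      e (⟨x, Subgroup.mem_zpowers x⟩ * h, n) = (x * (e (h, n)).1, (e (h, n)).2) := by
  obtain ⟨T, hT, hT1⟩ := (Subgroup.zpowers x).exists_isComplement_right 1
  have : Nonempty T := ⟨⟨1, hT1⟩⟩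
  obtain ⟨k⟩ : Nonempty (ℕ ≃ T × ℕ) := nonempty_equiv_of_countable
  refine ⟨((Equiv.refl _).prodCongr k).trans ((Equiv.prodAssoc _ _ _).symm.trans
    ((Equiv.ofBijective _ hT).prodCongr (Equiv.refl ℕ))), fun h n => ?_⟩
  simp [mul_assoc]

/-- The action of `G` on `G × ℕ` by left multiplication on the first factor. -/
def leftMulProdNat (G : Type*) [Group G] : G →* Equiv.Perm (G × ℕ) where
  toFun g := (Equiv.mulLeft g).prodCongr (Equiv.refl ℕ)
  map_one' := by ext <;> simp
  map_mul' a b := by ext <;> simp [mul_assoc]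

theorem leftMulProdNat_apply {G : Type*} [Group G] (g : G) (p : G × ℕ) :
    leftMulProdNat G g p = (g * p.1, p.2) := rfl

theorem leftMulProdNat_injective (G : Type*) [Group G] :
    Function.Injective (leftMulProdNat G) := fun a b h => by
  simpa [leftMulProdNat_apply] using DFunLike.congr_fun h (1, 0)

theorem isConj_leftMulProdNat {G : Type*} [Group G] [Countable G] {x y : G}
    (h : orderOf x = orderOf y) : IsConj (leftMulProdNat G x) (leftMulProdNat G y) := by
  obtain ⟨e, he⟩ := exists_equiv_zpowers_prod_nat x
  obtain ⟨e', he'⟩ := exists_equiv_zpowers_prod_nat y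
  have gen (z : G) : ∀ w, w ∈ Subgroup.zpowers
      (⟨z, Subgroup.mem_zpowers z⟩ : Subgroup.zpowers z) := by
    rintro ⟨_, n, rfl⟩
    exact ⟨n, by ext; simp⟩
  let m : Subgroup.zpowers x ≃* Subgroup.zpowers y :=
    mulEquivOfOrderOfEq (gen x) (gen y) (by simpa using h)
  have hm : m ⟨x, Subgroup.mem_zpowers x⟩ = ⟨y, Subgroup.mem_zpowers y⟩ :=
    mulEquivOfOrderOfEq_apply_gen _ _ _
  rw [isConj_iff]
  refine ⟨e.symm.trans ((m.toEquiv.prodCongr (Equiv.refl ℕ)).trans e'), ?_⟩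
  rw [mul_inv_eq_iff_eq_mul]
  ext1 p
  obtain ⟨⟨a, n⟩, rfl⟩ := e.surjective p
  simp [leftMulProdNat_apply, ← he, ← he', hm]

/-- A countable group embeds in a countable group in which any two elements of the same order of
the original group become conjugate. -/
theorem exists_countable_extension_isConj (G : Type) [Group G] [Countable G] :
    ∃ (H : GrpCat.{0}) (_ : Countable H) (φ : G →* H), Function.Injective φ ∧
      ∀ x y : G, orderOf x = orderOf y → IsConj (φ x) (φ y) := by
  have key (p : G × G) : ∃ c : Equiv.Perm (G × ℕ), orderOf p.1 = orderOf p.2 →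
      c * leftMulProdNat G p.1 * c⁻¹ = leftMulProdNat G p.2 := by
    by_cases h : orderOf p.1 = orderOf p.2
    · obtain ⟨c, hc⟩ := isConj_iff.1 (isConj_leftMulProdNat h)
      exact ⟨c, fun _ => hc⟩
    · exact ⟨1, fun h' => absurd h' h⟩
  choose c hc using key
  let F : FreeGroup (G ⊕ G × G) →* Equiv.Perm (G × ℕ) :=
    FreeGroup.lift (Sum.elim (leftMulProdNat G) c)
  have hG (g : G) : leftMulProdNat G g ∈ F.range := ⟨FreeGroup.of (Sum.inl g), by simp [F]⟩
  have hC (p : G × G) : c p ∈ F.range := ⟨FreeGroup.of (Sum.inr p), by simp [F]⟩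
  refine ⟨GrpCat.of F.range, (Set.countable_range F).to_subtype,
    (leftMulProdNat G).codRestrict F.range hG, fun a b h => ?_, fun x y h => ?_⟩
  · exact leftMulProdNat_injective G (congrArg Subtype.val h)
  · exact isConj_iff.2 ⟨⟨c (x, y), hC (x, y)⟩, Subtype.ext (hc (x, y) h)⟩

/-- Higman–Neumann–Neumann: every countable group embeds into a countable group in
which any two elements of the same order are conjugate. -/
theorem hnn_embedding_into_group_with_conjugate_elements_of_same_order
    (G : Type) [Group G] [Countable G] :
    ∃ (H : Type) (_ : Group H) (_ : Countable H) (φ : G →* H),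
      Function.Injective φ ∧
      ∀ x y : H, orderOf x = orderOf y → IsConj x y := by
  choose next hnext φ hφ hconj using
    fun K : {K : GrpCat.{0} // Countable K} =>
      have := K.2
      exists_countable_extension_isConj K.1
  let X : ℕ → {K : GrpCat.{0} // Countable K} :=
    fun n => Nat.rec ⟨GrpCat.of G, ‹_›⟩ (fun _ K => ⟨next K, hnext K⟩) n
  let s (n : ℕ) : (X n).1 ⟶ (X (n + 1)).1 := GrpCat.ofHom (φ (X n))
  let S : ℕ ⥤ GrpCat.{0} := Functor.ofSequence s
  let f (i j : ℕ) (h : i ≤ j) : (X i).1 →* (X j).1 := (S.map (homOfLE h)).hom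
  have f_self (i : ℕ) (a) : f i i le_rfl a = a := by
    change (S.map (𝟙 i)).hom a = a
    rw [S.map_id]
    rfl
  have f_comp (i j k : ℕ) (hij : i ≤ j) (hjk : j ≤ k) (a) :
      f j k hjk (f i j hij a) = f i k (hij.trans hjk) a := by
    change _ = (S.map (homOfLE hij ≫ homOfLE hjk)).hom a
    rw [S.map_comp]
    rfl
  have f_succ (i : ℕ) (a) : f i (i + 1) i.le_succ a = φ (X i) a := by
    change (S.map (homOfLE (Nat.le_add_right i 1))).hom a = _
    rw [Functor.ofSequence_map_homOfLE_succ]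
    rfl
  have f_inj (i j : ℕ) (h : i ≤ j) : Function.Injective (f i j h) := by
    induction j, h using Nat.le_induction with
    | base => intro a b hab; rwa [f_self, f_self] at hab
    | succ j h ih =>
      intro a b hab
      rw [← f_comp i j (j + 1) h j.le_succ, ← f_comp i j (j + 1) h j.le_succ,
        f_succ, f_succ] at hab
      exact ih (hφ _ hab)
  have : DirectedSystem (fun i => (X i).1) (f · · ·) :=
    ⟨fun i => f_self i, fun k j i => f_comp i j k⟩
  have (i : ℕ) : Countable (X i).1 := (X i).2
  let ι (i : ℕ) : (X i).1 →* DirectLimit (fun i => (X i).1) f :=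
    MonoidHom.mk' (fun a => ⟦⟨i, a⟩⟧) fun a b => (DirectLimit.mul_def (f := f) i a b).symm
  have ι_inj (i : ℕ) : Function.Injective (ι i) := fun a b hab => by
    obtain ⟨k, h, _, e⟩ := Quotient.exact hab
    exact f_inj i k h e
  refine ⟨DirectLimit (fun i => (X i).1) f, inferInstance, inferInstance, ι 0, ι_inj 0, ?_⟩
  refine DirectLimit.induction₂ f fun i a b h => ?_
  have hab : orderOf a = orderOf b := by
    rw [← orderOf_injective (ι i) (ι_inj i) a, ← orderOf_injective (ι i) (ι_inj i) b]
    exact h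
  have hι (a) : ι (i + 1) (φ (X i) a) = ι i a := by
    rw [← f_succ]
    exact DirectLimit.mk_apply (f := f) i (i + 1) a i.le_succ
  have := (ι (i + 1)).map_isConj (hconj (X i) a b hab)
  rwa [hι, hι] at this
end

section
/- Every countable group G can be embedded into a countable simple divisible group: there exists a countable group S that is simple and divisible (for every s ∈ S and every positive integer n there exists x ∈ S with x^n = s), together with an injective group homomorphism φ : G → S. -/
open Equiv

/-- A countable subset of a group lies in a countable subgroup closed under a given
countably-valued binary operation. -/
theorem exists_countable_subgroup_closed {U : Type*} [Group U] (F : U → U → Set U)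
    (hF : ∀ a b, (F a b).Countable) {C : Set U} (hC : C.Countable) :
    ∃ S : Subgroup U, (S : Set U).Countable ∧ C ⊆ S ∧ ∀ a ∈ S, ∀ b ∈ S, F a b ⊆ S := by
  let T : ℕ → Set U := fun n => Nat.rec (insert 1 C)
    (fun _ A => A ∪ ⋃ a ∈ A, ⋃ b ∈ A, insert (a * b⁻¹) (F a b)) n
  have hT : ∀ n, T (n + 1) = T n ∪ ⋃ a ∈ T n, ⋃ b ∈ T n, insert (a * b⁻¹) (F a b) :=
    fun _ => rfl
  have hcount : ∀ n, (T n).Countable := by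
    intro n
    induction n with
    | zero => exact hC.insert 1
    | succ n ih =>
      rw [hT]
      exact ih.union (ih.biUnion fun a _ => ih.biUnion fun b _ => (hF a b).insert _)
  have hmono : Monotone T := monotone_nat_of_le_succ fun n => by
    rw [hT]; exact Set.subset_union_left
  have hclosed : ∀ a ∈ ⋃ n, T n, ∀ b ∈ ⋃ n, T n, insert (a * b⁻¹) (F a b) ⊆ ⋃ n, T n := by
    intro a ha b hb
    obtain ⟨n, hn⟩ := Set.mem_iUnion.1 ha
    obtain ⟨m, hm⟩ := Set.mem_iUnion.1 hb
    refine Set.Subset.trans ?_ (Set.subset_iUnion T (max n m + 1))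
    rw [hT]
    exact Set.subset_union_of_subset_right (Set.subset_biUnion_of_mem
      (u := fun a => ⋃ b ∈ T (max n m), insert (a * b⁻¹) (F a b))
      (hmono (le_max_left n m) hn) |>.trans' (Set.subset_biUnion_of_mem
      (u := fun b => insert (a * b⁻¹) (F a b)) (hmono (le_max_right n m) hm))) _
  refine ⟨Subgroup.ofDiv (⋃ n, T n) ⟨1, Set.mem_iUnion.2 ⟨0, Set.mem_insert 1 C⟩⟩
    fun a ha b hb => hclosed a ha b hb (Set.mem_insert _ _), Set.countable_iUnion hcount, ?_, ?_⟩
  · exact (Set.subset_insert 1 C).trans (Set.subset_iUnion T 0)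
  · exact fun a ha b hb => (Set.subset_insert _ _).trans (hclosed a ha b hb)

theorem exists_countable_conjugators {U : Type*} [Group U] {g t : U}
    (ht : t ∈ Subgroup.normalClosure {g}) :
    ∃ F : Set U, F.Countable ∧ t ∈ Subgroup.closure ((fun s => s * g * s⁻¹) '' F) := by
  induction ht using Subgroup.closure_induction with
  | mem x hx =>
    obtain ⟨a, rfl, c, rfl⟩ := by
      simpa only [Group.mem_conjugatesOfSet_iff, isConj_iff] using hx
    exact ⟨{c}, Set.countable_singleton c, Subgroup.subset_closure ⟨c, rfl, rfl⟩⟩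
  | one => exact ⟨∅, Set.countable_empty, one_mem _⟩
  | mul x y _ _ hx hy =>
    obtain ⟨A, hA, hxA⟩ := hx
    obtain ⟨B, hB, hyB⟩ := hy
    exact ⟨A ∪ B, hA.union hB, mul_mem
      (Subgroup.closure_mono (Set.image_mono Set.subset_union_left) hxA)
      (Subgroup.closure_mono (Set.image_mono Set.subset_union_right) hyB)⟩
  | inv x _ hx =>
    obtain ⟨A, hA, hxA⟩ := hx
    exact ⟨A, hA, inv_mem hxA⟩

/-- In a simple divisible group, each countable subset lies in a countable simple divisible
subgroup. -/
theorem exists_countable_simple_divisible_subgroup {U : Type*} [Group U] [IsSimpleGroup U]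
    (hdiv : ∀ s : U, ∀ n : ℕ, 0 < n → ∃ x : U, x ^ n = s) {C : Set U} (hC : C.Countable) :
    ∃ S : Subgroup U, Countable S ∧ C ⊆ S ∧ IsSimpleGroup S ∧
      ∀ s : S, ∀ n : ℕ, 0 < n → ∃ x : S, x ^ n = s := by
  have hroot : ∀ (s : U) (n : ℕ), ∃ x : U, 0 < n → x ^ n = s := by
    intro s n
    by_cases hn : 0 < n
    · obtain ⟨x, hx⟩ := hdiv s n hn
      exact ⟨x, fun _ => hx⟩
    · exact ⟨1, fun h => absurd h hn⟩
  choose root hroot using hroot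
  have hconj : ∀ g t : U, ∃ F : Set U, F.Countable ∧
      (g ≠ 1 → t ∈ Subgroup.closure ((fun s => s * g * s⁻¹) '' F)) := by
    intro g t
    by_cases hg : g = 1
    · exact ⟨∅, Set.countable_empty, fun h => absurd hg h⟩
    · have htop : Subgroup.normalClosure {g} = ⊤ := by
        refine (Subgroup.Normal.eq_bot_or_eq_top Subgroup.normalClosure_normal).resolve_left
          fun h => hg ?_
        rw [← Subgroup.mem_bot, ← h]
        exact Subgroup.subset_normalClosure rfl
      obtain ⟨F, hF, ht⟩ := exists_countable_conjugators (htop ▸ Subgroup.mem_top t)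
      exact ⟨F, hF, fun _ => ht⟩
  choose W hW hWmem using hconj
  obtain ⟨u, hu⟩ := exists_ne (1 : U)
  obtain ⟨S, hS, hCS, hcl⟩ := exists_countable_subgroup_closed
    (fun a b => W a b ∪ Set.range (root a)) (fun a b => (hW a b).union (Set.countable_range _))
    (hC.insert u)
  have huS : u ∈ S := hCS (Set.mem_insert _ _)
  refine ⟨S, hS.to_subtype, (Set.subset_insert _ _).trans hCS, ?_, ?_⟩
  · have : Nontrivial S := ⟨⟨u, huS⟩, 1, fun h => hu (congrArg Subtype.val h)⟩
    refine ⟨fun H hH => or_iff_not_imp_left.2 fun hbot => ?_⟩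
    obtain ⟨g, hgH, hg⟩ := H.bot_or_exists_ne_one.resolve_left hbot
    have hg' : (g : U) ≠ 1 := fun h => hg (Subtype.ext h)
    refine (Subgroup.eq_top_iff' H).2 fun t => ?_
    have hle : Subgroup.closure ((fun s => s * (g : U) * s⁻¹) '' W g t) ≤ H.map S.subtype := by
      rw [Subgroup.closure_le]
      rintro _ ⟨s, hs, rfl⟩
      exact ⟨_, hH.conj_mem g hgH ⟨s, hcl g g.2 t t.2 (Or.inl hs)⟩, rfl⟩
    obtain ⟨t', ht', h⟩ := hle (hWmem g t hg')
    exact Subtype.ext h ▸ ht'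
  · intro s n hn
    exact ⟨⟨root s n, hcl s s.2 s s.2 (Or.inr ⟨n, rfl⟩)⟩, Subtype.ext (hroot s n hn)⟩

/-- The permutation `p` acting on every fibre of `I × X → I`. -/
def amplify (I : Type*) {X : Type*} : Perm X →* Perm (I × X) where
  toFun p := prodShear (Equiv.refl I) fun _ => p
  map_one' := rfl
  map_mul' _ _ := rfl

@[simp] theorem amplify_apply {I X : Type*} (p : Perm X) (z : I × X) :
    amplify I p z = (z.1, p z.2) := rfl

theorem amplify_inv_apply {I X : Type*} (p : Perm X) (z : I × X) :
    (amplify I p)⁻¹ z = (z.1, p⁻¹ z.2) := rfl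

theorem prodShear_pow_apply {I X : Type*} (σ : Perm I) (p : Perm X) (c : I → ℕ) (m : ℕ)
    (i : I) (a : X) :
    (prodShear σ (fun j => p ^ c j) ^ m) (i, a) =
      ((σ ^ m) i, (p ^ ∑ l ∈ Finset.range m, c ((σ ^ l) i)) a) := by
  induction m with
  | zero => simp
  | succ m ih =>
    rw [pow_succ', Perm.mul_apply, ih, Finset.sum_range_succ, add_comm (∑ _ ∈ _, _), pow_add p,
      pow_succ' σ]
    rfl

theorem sum_range_ite_zmod {n : ℕ} [NeZero n] (k : ZMod n) :
    ∑ l ∈ Finset.range n, (if k + (l : ZMod n) = 0 then 1 else 0) = 1 := by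
  rw [Finset.sum_eq_single_of_mem (-k).val (Finset.mem_range.2 (ZMod.val_lt _))]
  · simp
  · intro l hl hne
    refine if_neg fun h => hne ?_
    rw [← eq_neg_of_add_eq_zero_right h, ZMod.val_cast_of_lt (Finset.mem_range.1 hl)]

theorem exists_pow_eq_amplify {I X : Type*} [Countable I] [Infinite I] (p : Perm X) {n : ℕ}
    (hn : 0 < n) : ∃ x : Perm (I × X), x ^ n = amplify I p := by
  have : NeZero n := ⟨hn.ne'⟩
  obtain ⟨e⟩ : Nonempty (I ≃ ℕ × ZMod n) := nonempty_equiv_of_countable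
  let σ : Perm I := e.symm.permCongr (prodCongr (Equiv.refl ℕ) (Equiv.addRight 1))
  have hσ : ∀ (l : ℕ) (i : I), (σ ^ l) i = e.symm ((e i).1, (e i).2 + l) := by
    intro l i
    induction l with
    | zero => simp
    | succ l ih =>
      rw [pow_succ', Perm.mul_apply, ih]
      simp [σ, permCongr_apply, add_assoc]
  refine ⟨prodShear σ fun i => p ^ (if (e i).2 = 0 then 1 else 0), Equiv.ext fun ⟨i, a⟩ => ?_⟩
  rw [prodShear_pow_apply σ p (fun i => if (e i).2 = 0 then 1 else 0)]
  simp only [hσ, apply_symm_apply, sum_range_ite_zmod]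
  simp

theorem commutator_mem_of_commute {P : Type*} [Group P] {N : Subgroup P} [hN : N.Normal]
    {g h k : P} (hg : g ∈ N) (hh : Commute (g * h * g⁻¹) h) (hk : Commute (g * h * g⁻¹) k) :
    h⁻¹ * k * h * k⁻¹ ∈ N := by
  have hw : g * h * g⁻¹ * h⁻¹ ∈ N := by
    simpa only [mul_assoc] using mul_mem hg (hN.conj_mem _ (inv_mem hg) h)
  have := mul_mem hw (hN.conj_mem _ (inv_mem hw) k)
  convert this using 1
  generalize g * h * g⁻¹ = w at hh hk
  have hc : Commute w (h⁻¹ * k * h) := (hh.inv_right.mul_right hk).mul_right hh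
  calc h⁻¹ * k * h * k⁻¹ = h⁻¹ * k * h * w * w⁻¹ * k⁻¹ := by group
    _ = w * (h⁻¹ * k * h) * w⁻¹ * k⁻¹ := by rw [hc.eq]
    _ = w * h⁻¹ * (k * (w * h⁻¹)⁻¹ * k⁻¹) := by
      rw [mul_inv_rev, inv_inv]
      simp only [mul_assoc]

/-- The permutation `p` acting on the fibres over one half of the index set. -/
def amplifyHalf {X : Type*} (b : Bool) (p : Perm X) : Perm ((ℤ × Bool) × X) :=
  prodShear (Equiv.refl _) fun i => if i.2 = b then p else 1

theorem amplifyHalf_mem {X : Type*} [Countable X] {N : Subgroup (Perm ((ℤ × Bool) × X))}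
    [hN : N.Normal] {g : Perm X} (hg : g ≠ 1) (hgN : amplify (ℤ × Bool) g ∈ N) (b : Bool)
    (p : Perm X) : amplifyHalf b p ∈ N := by
  classical
  obtain ⟨a, ha⟩ : ∃ a, g a ≠ a := by
    by_contra! h
    exact hg (Equiv.ext h)
  let Z := (ℤ × Bool) × X
  have : Infinite {z : Z // z.1.2 = b} :=
    Infinite.of_injective (fun n : ℤ => ⟨((n, b), a), rfl⟩) fun m n h =>
      congrArg (fun z => z.1.1.1) h
  have : Infinite {z : Z // ¬ z.1.2 = b} :=
    Infinite.of_injective (fun n : ℤ => ⟨((n, !b), a), by simp⟩) fun m n h =>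
      congrArg (fun z => z.1.1.1) h
  have : Infinite {z : Z // z.2 = a} :=
    Infinite.of_injective (fun n : ℤ => ⟨((n, b), a), rfl⟩) fun m n h =>
      congrArg (fun z => z.1.1.1) h
  have : Infinite {z : Z // ¬ z.2 = a} :=
    Infinite.of_injective (fun n : ℤ => ⟨((n, b), g a), ha⟩) fun m n h =>
      congrArg (fun z => z.1.1.1) h
  obtain ⟨e⟩ : Nonempty ({z : Z // z.1.2 = b} ≃ {z : Z // z.2 = a}) := nonempty_equiv_of_countable
  obtain ⟨f⟩ : Nonempty ({z : Z // ¬ z.1.2 = b} ≃ {z : Z // ¬ z.2 = a}) :=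
    nonempty_equiv_of_countable
  let θ : Perm Z := Equiv.subtypeCongr e f
  have hθ : ∀ z : Z, z.1.2 = b → (θ z).2 = a := by
    intro z hz
    have : θ z = e ⟨z, hz⟩ :=
      congrArg (fun w => sumCompl (fun z : Z => z.2 = a) (Sum.map e f w))
        (sumCompl_symm_apply_of_pos (p := fun z : Z => z.1.2 = b) hz)
    exact this ▸ (e ⟨z, hz⟩).2
  have hθ' : ∀ z : Z, z.1.2 ≠ b → (θ z).2 ≠ a := by
    intro z hz
    have : θ z = f ⟨z, hz⟩ :=
      congrArg (fun w => sumCompl (fun z : Z => z.2 = a) (Sum.map e f w))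
        (sumCompl_symm_apply_of_neg (p := fun z : Z => z.1.2 = b) hz)
    exact this ▸ (f ⟨z, hz⟩).2
  let g' : Perm Z := θ⁻¹ * amplify (ℤ × Bool) g * θ
  have hg'N : g' ∈ N := by simpa using hN.conj_mem _ hgN θ⁻¹
  have hg' : ∀ z : Z, z.1.2 = b → (g'⁻¹ z).1.2 ≠ b := by
    intro z hz hz'
    have h1 := hθ _ hz'
    have h2 : θ (g'⁻¹ z) = (amplify (ℤ × Bool) g)⁻¹ (θ z) := by simp [g', mul_assoc]
    rw [h2, amplify_inv_apply, hθ z hz] at h1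
    exact ha (Perm.inv_eq_iff_eq.1 h1).symm
  have hcomm : ∀ h k : Perm Z, (∀ z, z.1.2 ≠ b → h z = z) → (∀ z, z.1.2 ≠ b → k z = z) →
      Commute (g' * h * g'⁻¹) k := by
    intro h k hh hk
    refine Perm.Disjoint.commute fun z => ?_
    by_cases hz : z.1.2 = b
    · left
      rw [Perm.mul_apply, Perm.mul_apply, hh _ (hg' z hz), ← Perm.mul_apply,
        mul_inv_cancel, Perm.one_apply]
    · exact Or.inr (hk z hz)
  let h : Perm Z := prodShear (Equiv.refl _) fun i => if i.2 = b then p ^ (-i.1) else 1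
  let k : Perm Z := prodCongr
    ((Equiv.prodComm _ _).trans <| (prodShear (Equiv.refl Bool) fun c =>
      if c = b then Equiv.addRight (1 : ℤ) else 1).trans (Equiv.prodComm _ _)) (Equiv.refl X)
  have hh_pos : ∀ n x, h ((n, b), x) = ((n, b), (p ^ (-n)) x) := fun n x =>
    congrArg (fun q : Perm X => ((n, b), q x)) (if_pos rfl)
  have hk_pos : ∀ n x, k ((n, b), x) = ((n + 1, b), x) := fun n x =>
    congrArg (fun q : Perm ℤ => ((q n, b), x)) (if_pos rfl)
  have hh : ∀ z, z.1.2 ≠ b → h z = z := by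
    rintro ⟨⟨n, c⟩, x⟩ hc
    exact congrArg (fun q : Perm X => ((n, c), q x)) (if_neg hc)
  have hk : ∀ z, z.1.2 ≠ b → k z = z := by
    rintro ⟨⟨n, c⟩, x⟩ hc
    exact congrArg (fun q : Perm ℤ => ((q n, c), x)) (if_neg hc)
  have hp_pos : ∀ n x, amplifyHalf b p ((n, b), x) = ((n, b), p x) := fun n x =>
    congrArg (fun q : Perm X => ((n, b), q x)) (if_pos rfl)
  have hp : ∀ z, z.1.2 ≠ b → amplifyHalf b p z = z := by
    rintro ⟨⟨n, c⟩, x⟩ hc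
    exact congrArg (fun q : Perm X => ((n, c), q x)) (if_neg hc)
  have := commutator_mem_of_commute (N := N) hg'N (hcomm h h hh hh) (hcomm h k hh hk)
  convert this using 1
  rw [eq_mul_inv_iff_mul_eq, mul_assoc, eq_inv_mul_iff_mul_eq]
  ext1 z
  simp only [Perm.mul_apply]
  by_cases hc : z.1.2 = b
  · obtain ⟨⟨n, c⟩, x⟩ := z
    obtain rfl : c = b := hc
    rw [hk_pos, hp_pos, hh_pos, hh_pos, hk_pos, ← Perm.mul_apply, ← zpow_add_one]
    simp
  · rw [hk z hc, hp z hc, hh z hc, hk z hc]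

theorem amplify_mem {X : Type*} [Countable X] {N : Subgroup (Perm ((ℤ × Bool) × X))}
    [N.Normal] {g : Perm X} (hg : g ≠ 1) (hgN : amplify (ℤ × Bool) g ∈ N) (p : Perm X) :
    amplify (ℤ × Bool) p ∈ N := by
  have : amplify (ℤ × Bool) p = amplifyHalf true p * amplifyHalf false p := by
    ext1 ⟨⟨n, c⟩, x⟩
    cases c <;> simp [amplifyHalf]
  rw [this]
  exact mul_mem (amplifyHalf_mem hg hgN _ _) (amplifyHalf_mem hg hgN _ _)

theorem isSimpleGroup_of_tower {P U : Type*} [Group P] [Group U] [Nontrivial U]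
    (φ : ℕ → P →* U) (α : P →* P) (hφ : ∀ n p, φ (n + 1) (α p) = φ n p)
    (hsurj : ∀ u, ∃ n p, φ n p = u)
    (hα : ∀ N : Subgroup P, N.Normal → ∀ g ≠ 1, α g ∈ N → ∀ p, α p ∈ N) :
    IsSimpleGroup U := by
  have hlift : ∀ n k p, ∃ q, φ (n + k) q = φ n p := by
    intro n k
    induction k with
    | zero => exact fun p => ⟨p, rfl⟩
    | succ k ih =>
      intro p
      obtain ⟨q, hq⟩ := ih p
      exact ⟨α q, (hφ (n + k) q).trans hq⟩
  refine ⟨fun N hN => or_iff_not_imp_left.2 fun hbot => ?_⟩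
  obtain ⟨u, huN, hu⟩ := N.bot_or_exists_ne_one.resolve_left hbot
  refine (Subgroup.eq_top_iff' N).2 fun t => ?_
  obtain ⟨n, p, rfl⟩ := hsurj u
  obtain ⟨m, q, rfl⟩ := hsurj t
  obtain ⟨p', hp'⟩ := hlift n m p
  obtain ⟨q', hq'⟩ := hlift m n q
  rw [add_comm] at hq'
  rw [← hp'] at huN hu
  rw [← hq', ← hφ]
  refine hα (N.comap (φ (n + m + 1))) inferInstance p' ?_ ?_ q'
  · rintro rfl
    exact hu (map_one _)
  · rwa [Subgroup.mem_comap, hφ]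

/-- Splitting off the first term of a sequence and absorbing it in the second factor. -/
def absorbHead {I X : Type*} (ε : I × X ≃ X) : Perm ((ℕ → I) × X) where
  toFun z := (fun n => z.1 (n + 1), ε (z.1 0, z.2))
  invFun z := (fun n => Nat.casesOn n (ε.symm z.2).1 z.1, (ε.symm z.2).2)
  left_inv := by
    rintro ⟨y, x⟩
    refine Prod.ext (funext fun n => ?_) ?_
    · cases n <;> simp
    · simp
  right_inv := by
    rintro ⟨y, x⟩
    simp

/-- An identification of `I × X` with `X` turns `amplify I` into an endomorphism of `Perm X`; there
is a group containing the direct limit of its iterates. -/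
theorem exists_tower_limit {I X : Type*} [Nonempty I] (ε : I × X ≃ X) :
    ∃ (U : Subgroup (Perm ((ℕ → I) × X))) (φ : ℕ → Perm X →* U),
      (∀ n, Function.Injective (φ n)) ∧
      (∀ n p, φ (n + 1) (ε.permCongrHom (amplify I p)) = φ n p) ∧ ∀ u, ∃ n p, φ n p = u := by
  let s := absorbHead ε
  let ψ : ℕ → Perm X →* Perm ((ℕ → I) × X) := fun n =>
    (MulAut.conj (s ^ n)⁻¹).toMonoidHom.comp (amplify (ℕ → I))
  have hinj : ∀ n, Function.Injective (ψ n) := fun n =>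
    (MulAut.conj (s ^ n)⁻¹).injective.comp fun p q h => Equiv.ext fun x =>
      congrArg Prod.snd (Equiv.congr_fun h (fun _ => Classical.arbitrary I, x))
  have hstep : ∀ n p, ψ (n + 1) (ε.permCongrHom (amplify I p)) = ψ n p := by
    intro n p
    have key : amplify (ℕ → I) (ε.permCongrHom (amplify I p)) = s * amplify (ℕ → I) p * s⁻¹ := by
      rw [eq_mul_inv_iff_mul_eq]
      ext1 ⟨y, x⟩
      simp [s, absorbHead, permCongrHom, permCongr_apply]
    change (s ^ (n + 1))⁻¹ * amplify (ℕ → I) (ε.permCongrHom (amplify I p)) * (s ^ (n + 1))⁻¹⁻¹ =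
      (s ^ n)⁻¹ * amplify (ℕ → I) p * (s ^ n)⁻¹⁻¹
    rw [key, pow_succ']
    group
  have hmono : Monotone fun n => (ψ n).range := monotone_nat_of_le_succ fun n => by
    rintro _ ⟨p, rfl⟩
    exact ⟨_, hstep n p⟩
  refine ⟨⨆ n, (ψ n).range, fun n => (ψ n).codRestrict _ fun p =>
    le_iSup (fun n => (ψ n).range) n ⟨p, rfl⟩, fun n p q h => hinj n (congrArg Subtype.val h),
    fun n p => Subtype.ext (hstep n p), fun ⟨u, hu⟩ => ?_⟩
  obtain ⟨n, p, hp⟩ := (Subgroup.mem_iSup_of_directed hmono.directed_le).1 hu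
  exact ⟨n, p, Subtype.ext hp⟩

/-- The symmetric group of a countably infinite set embeds into a simple divisible group. -/
theorem exists_simple_divisible_of_perm (X : Type) [Countable X] [Infinite X] :
    ∃ (U : Type) (_ : Group U), IsSimpleGroup U ∧
      (∀ s : U, ∀ n : ℕ, 0 < n → ∃ x : U, x ^ n = s) ∧
      ∃ φ : Perm X →* U, Function.Injective φ := by
  classical
  obtain ⟨ε⟩ : Nonempty ((ℤ × Bool) × X ≃ X) := nonempty_equiv_of_countable
  obtain ⟨U, φ, hinj, hstep, hsurj⟩ := exists_tower_limit ε
  have : Nontrivial U := (hinj 0).nontrivial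
  refine ⟨U, inferInstance, ?_, ?_, φ 0, hinj 0⟩
  · refine isSimpleGroup_of_tower φ (ε.permCongrHom.toMonoidHom.comp (amplify (ℤ × Bool)))
      hstep hsurj fun N hN g hg hgN p => ?_
    exact amplify_mem (N := N.comap ε.permCongrHom.toMonoidHom) hg hgN p
  · intro u m hm
    obtain ⟨n, p, rfl⟩ := hsurj u
    obtain ⟨x, hx⟩ := exists_pow_eq_amplify (I := ℤ × Bool) p hm
    exact ⟨φ (n + 1) (ε.permCongrHom x), by rw [← map_pow, ← map_pow, hx, hstep]⟩

theorem embedding_into_countable_simple_divisible_group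
    (G : Type) [Group G] [Countable G] :
    ∃ (S : Type) (_ : Group S) (_ : Countable S),
      IsSimpleGroup S ∧
      (∀ s : S, ∀ n : ℕ, 0 < n → ∃ x : S, x ^ n = s) ∧
      ∃ φ : G →* S, Function.Injective φ := by
  obtain ⟨U, _, _, hdiv, φ, hφ⟩ := exists_simple_divisible_of_perm (ℕ × G)
  let ψ : G →* U := φ.comp ((amplify ℕ).comp (MulAction.toPermHom G G))
  have hψ : Function.Injective ψ := hφ.comp fun g h hgh => by
    simpa using congrArg Prod.snd (Equiv.congr_fun hgh (0, 1))
  obtain ⟨S, hS, hle, hsimple, hSdiv⟩ :=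
    exists_countable_simple_divisible_subgroup hdiv (Set.countable_range ψ)
  exact ⟨S, inferInstance, hS, hsimple, hSdiv, ψ.codRestrict S fun g => hle ⟨g, rfl⟩,
    fun g h hgh => hψ (congrArg Subtype.val hgh)⟩
end

section
/- (P. Hall) Every countable group G can be embedded into a 3-generated simple group: there exists a simple group S generated by some 3 elements, together with an injective group homomorphism φ : G → S. -/
open Monoid

/-- A group `H` with a nontrivial element `h` whose normal closure is `H` has a simple quotient in
which `h` survives. -/
theorem exists_isSimpleGroup_quotient {H : Type*} [Group H] (h : H) (h_ne : h ≠ 1)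
    (h_top : ∀ N : Subgroup H, N.Normal → h ∈ N → N = ⊤) :
    ∃ (N : Subgroup H) (_ : N.Normal), h ∉ N ∧ IsSimpleGroup (H ⧸ N) := by
  obtain ⟨N, -, ⟨hN, hhN⟩, hmax⟩ := zorn_le_nonempty₀ {N : Subgroup H | N.Normal ∧ h ∉ N}
    (by
      intro c hc hchain y hy
      have hmem {x : H} : x ∈ sSup c ↔ ∃ s ∈ c, x ∈ s :=
        Subgroup.mem_sSup_of_directedOn ⟨y, hy⟩ hchain.directedOn
      refine ⟨sSup c, ⟨⟨fun x hx g => ?_⟩, fun hh => ?_⟩, fun z hz => le_sSup hz⟩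
      · obtain ⟨s, hs, hxs⟩ := hmem.1 hx
        exact hmem.2 ⟨s, hs, (hc hs).1.conj_mem x hxs g⟩
      · obtain ⟨s, hs, hhs⟩ := hmem.1 hh
        exact (hc hs).2 hhs)
    ⊥ ⟨inferInstance, by simpa using h_ne⟩
  refine ⟨N, hN, hhN, ?_⟩
  have hnt : Nontrivial (H ⧸ N) :=
    ⟨⟨(h : H ⧸ N), 1, fun e => hhN ((QuotientGroup.eq_one_iff h).1 e)⟩⟩
  refine ⟨fun M hM => ?_⟩
  have hcomap : (M.comap (QuotientGroup.mk' N)).Normal := hM.comap _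
  have hsurj : Function.Surjective (QuotientGroup.mk' N) := QuotientGroup.mk'_surjective N
  have hle : N ≤ M.comap (QuotientGroup.mk' N) := fun x hx => by
    have : (QuotientGroup.mk' N) x = 1 := (QuotientGroup.eq_one_iff x).2 hx
    simp [Subgroup.mem_comap, this, M.one_mem]
  rw [← Subgroup.map_comap_eq_self_of_surjective hsurj M]
  by_cases hh : h ∈ M.comap (QuotientGroup.mk' N)
  · right
    rw [h_top _ hcomap hh, Subgroup.map_top_of_surjective _ hsurj]
  · left
    rw [Subgroup.map_eq_bot_iff, QuotientGroup.ker_mk']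
    exact hmax ⟨hcomap, hh⟩ hle

/-- The amalgamated product of two groups along a common subgroup. -/
theorem exists_amalgam {F A B : Type} [Group F] [hA : Group A] [hB : Group B] (φ : F →* A) (ψ : F →* B)
    (hφ : Function.Injective φ) (hψ : Function.Injective ψ) :
    ∃ (P : Type) (_ : Group P) (α : A →* P) (β : B →* P), Function.Injective α ∧
      (∀ x, α (φ x) = β (ψ x)) ∧ α.range ⊔ β.range = ⊤ := by
  let X : Bool → Type := fun i => cond i A B
  let grp : ∀ i, Group (X i) := fun i => Bool.rec (motive := fun i => Group (X i)) hB hA i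
  let f : ∀ i, F →* X i := fun i => Bool.rec (motive := fun i => F →* X i) ψ φ i
  have hf : ∀ i, Function.Injective (f i) := fun i => match i with
    | true => hφ
    | false => hψ
  let α : A →* PushoutI f := PushoutI.of (φ := f) true
  let β : B →* PushoutI f := PushoutI.of (φ := f) false
  refine ⟨PushoutI f, inferInstance, α, β, PushoutI.of_injective hf true, fun x =>
    (PushoutI.of_apply_eq_base f true x).trans (PushoutI.of_apply_eq_base f false x).symm, ?_⟩
  rw [eq_top_iff]
  intro x _
  have hα (a : A) : α a ∈ α.range ⊔ β.range := le_sup_left (a := α.range) ⟨a, rfl⟩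
  have hβ (b : B) : β b ∈ α.range ⊔ β.range := le_sup_right (a := α.range) ⟨b, rfl⟩
  induction x using PushoutI.induction_on with
  | of i g => match i with
    | true => exact hα g
    | false => exact hβ g
  | base h =>
    rw [← PushoutI.of_apply_eq_base f true h]
    exact hα _
  | mul x y hx hy => exact mul_mem (hx trivial) (hy trivial)

/-- A faithful permutation model of the interaction of `G` and `ℤ` in the free product `G ∗ ℤ`. -/
theorem exists_perm_pingPong.{w} (G : Type w) [Group G] [Countable G] :
    ∃ (Ω : Type w) (σ : G →* Equiv.Perm Ω) (y : Equiv.Perm Ω) (l : Ω → ℤ),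
      Function.Surjective l ∧ (∀ x, l (y x) = l x + 1) ∧
        ∀ g ≠ 1, ∀ x, l x ≠ 0 → l (σ g x) = 0 := by
  classical
  let l : G × ℤ × ℕ → ℤ := fun x => if x.1 = 1 then x.2.1 else 0
  have hinf (n : ℤ) : Infinite {x // l x = n} :=
    Infinite.of_injective (fun k : ℕ => ⟨(1, n, k), by simp [l]⟩) fun a b h => by simpa using h
  let e : G × ℤ × ℕ ≃ ℤ × ℕ := (Equiv.sigmaFiberEquiv l).symm.trans <|
    (Equiv.sigmaCongrRight fun n => (nonempty_equiv_of_countable (β := ℕ)).some).trans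
      (Equiv.sigmaEquivProd ℤ ℕ)
  have he (x) : (e x).1 = l x := rfl
  let σ : G →* Equiv.Perm (G × ℤ × ℕ) :=
    { toFun := fun g => (Equiv.mulLeft g).prodCongr (Equiv.refl _)
      map_one' := by ext x <;> simp
      map_mul' := fun g h => by ext x <;> simp [mul_assoc] }
  refine ⟨G × ℤ × ℕ, σ, (e.trans ((Equiv.addRight 1).prodCongr (Equiv.refl _))).trans e.symm, l,
    fun n => ⟨(1, n, 0), by simp [l]⟩, fun x => ?_, fun g hg x hx => ?_⟩
  · rw [← he, ← he]
    simp
  · have h1 : x.1 = 1 := by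
      by_contra h
      simp [l, h] at hx
    simp [l, σ, h1, hg]

/-- In the free product `G ∗ ⟨y⟩`, the elements `y ^ a i * g i * y ^ (-b i)` with all exponents
distinct and `g i ≠ 1`, freely generate a free group. -/
theorem injective_lift_coprod_int.{w} {G I : Type w} [Group G] [Countable G] [Nontrivial I]
    (g : I → G) (hg : ∀ i, g i ≠ 1) (a b : I → ℤ) (ha : Function.Injective a)
    (hb : Function.Injective b) (hab : ∀ i j, a i ≠ b j) :
    Function.Injective (FreeGroup.lift fun i =>
      (Coprod.inr (Multiplicative.ofAdd (1 : ℤ)) ^ a i * Coprod.inl (g i) *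
        Coprod.inr (Multiplicative.ofAdd (1 : ℤ)) ^ (-b i) :
          Coprod G (Multiplicative ℤ))) := by
  obtain ⟨Ω, σ, y, l, hl, hy, hσ⟩ := exists_perm_pingPong G
  have hyz (n : ℤ) (x : Ω) : l ((y ^ n) x) = l x + n := by
    induction n using Int.induction_on generalizing x with
    | zero => simp
    | succ n ih => rw [zpow_add_one, Equiv.Perm.mul_apply, ih, hy]; ring
    | pred n ih =>
      have := hy (y⁻¹ x)
      rw [← Equiv.Perm.mul_apply, mul_inv_cancel, Equiv.Perm.one_apply] at this
      rw [zpow_sub_one, Equiv.Perm.mul_apply, ih]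
      linarith
  let π : Coprod G (Multiplicative ℤ) →* Equiv.Perm Ω := Coprod.lift σ (zpowersHom _ y)
  refine Function.Injective.of_comp (f := π) ?_
  rw [← MonoidHom.coe_comp]
  have hcomp : π.comp (FreeGroup.lift fun i =>
      (Coprod.inr (Multiplicative.ofAdd (1 : ℤ)) ^ a i * Coprod.inl (g i) *
        Coprod.inr (Multiplicative.ofAdd (1 : ℤ)) ^ (-b i) : Coprod G (Multiplicative ℤ))) =
      FreeGroup.lift fun i => y ^ a i * σ (g i) * y ^ (-b i) := by
    ext i
    simp [π]
  rw [hcomp]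
  refine FreeGroup.injective_lift_of_ping_pong (fun i => y ^ a i * σ (g i) * y ^ (-b i))
    (fun i => {x | l x = a i}) (fun i => {x | l x = b i}) (fun i => hl (a i)) ?_ ?_ ?_ ?_ ?_
  · exact fun i j hij => Set.disjoint_left.2 fun x hx hx' => hij (ha (hx.symm.trans hx'))
  · exact fun i j hij => Set.disjoint_left.2 fun x hx hx' => hij (hb (hx.symm.trans hx'))
  · exact fun i j => Set.disjoint_left.2 fun x hx hx' => hab i j (hx.symm.trans hx')
  · rintro i _ ⟨x, hx, rfl⟩
    have hne : l ((y ^ (-b i)) x) ≠ 0 := by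
      rw [hyz]
      exact fun h => hx (by simpa using (by linarith : l x = b i))
    change l ((y ^ a i * σ (g i) * y ^ (-b i)) x) = a i
    rw [Equiv.Perm.mul_apply, Equiv.Perm.mul_apply, hyz, hσ _ (hg i) _ hne, zero_add]
  · rintro i _ ⟨x, hx, rfl⟩
    have hne : l ((y ^ (-a i)) x) ≠ 0 := by
      rw [hyz]
      exact fun h => hx (by simpa using (by linarith : l x = a i))
    change l ((y ^ a i * σ (g i) * y ^ (-b i))⁻¹ x) = b i
    rw [mul_inv_rev, mul_inv_rev, ← zpow_neg, ← zpow_neg, neg_neg, ← map_inv, ← mul_assoc,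
      Equiv.Perm.mul_apply, Equiv.Perm.mul_apply, hyz, hσ _ (inv_ne_one.2 (hg i)) _ hne, zero_add]

theorem eq_one_of_twisted_relations {Q : Type*} [Group Q] {u v y : Q} (m : ℤ)
    (h0 : y ^ (10 : ℤ) = u ^ (m + 1) * v * u ^ (-(m + 7)))
    (h1 : y ^ (10 : ℤ) = u ^ (m + 3) * v * u ^ (-(m + 8)))
    (h2 : y ^ (10 : ℤ) = u ^ (m + 6) * v * u ^ (-(m + 9)))
    (h3 : y ^ (11 : ℤ) = u ^ (m + 10) * v * u ^ (-(m + 11))) : u = 1 ∧ v = 1 ∧ y = 1 := by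
  have e1 : y ^ (10 : ℤ) * u = u ^ 2 * y ^ (10 : ℤ) := by
    nth_rw 1 [h1]
    rw [h0]
    group
  have e2 : y ^ (10 : ℤ) * u ^ 2 = u ^ 5 * y ^ (10 : ℤ) := by
    nth_rw 1 [h2]
    rw [h0]
    group
  have e3 : y ^ (10 : ℤ) * u ^ 2 = u ^ 4 * y ^ (10 : ℤ) := by
    rw [pow_two, ← mul_assoc, e1, mul_assoc, e1, ← mul_assoc, ← pow_add]
  have hu : u = 1 := by
    have := mul_right_cancel (e2.symm.trans e3)
    rwa [pow_succ u 4, mul_eq_left] at this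
  subst hu
  simp only [one_zpow, one_mul, mul_one] at h0 h3
  have hy : y = 1 := by
    have := h3.trans h0.symm
    rwa [show (11 : ℤ) = 10 + 1 from rfl, zpow_add_one, mul_eq_left] at this
  subst hy
  exact ⟨rfl, by simpa using h0.symm, rfl⟩

theorem eq_ofAdd_one_zpow (n : Multiplicative ℤ) : n = Multiplicative.ofAdd 1 ^ n.toAdd := by
  rw [← ofAdd_zsmul]
  simp

/-- The range of a homomorphism on `A ∗ ℤ` lies in any subgroup containing the images of `A` and of
the generator of `ℤ`. -/
theorem range_coprod_int_le {A P : Type*} [Group A] [Group P]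
    (f : Coprod A (Multiplicative ℤ) →* P) (K : Subgroup P) (hA : ∀ a, f (Coprod.inl a) ∈ K)
    (h1 : f (Coprod.inr (Multiplicative.ofAdd 1)) ∈ K) : f.range ≤ K := by
  rintro _ ⟨x, rfl⟩
  induction x using Coprod.induction_on with
  | inl a => exact hA a
  | inr n =>
    rw [eq_ofAdd_one_zpow n, map_zpow, map_zpow]
    exact K.zpow_mem h1 _
  | mul x y hx hy => rw [map_mul]; exact mul_mem hx hy

/-- Every nontrivial countable group embeds into a 3-generated group in which each of its
nontrivial elements is a normal generator. -/
theorem exists_embedding_normally_generating (G : Type) [Group G] [Countable G] [Nontrivial G] :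
    ∃ (H : Type) (_ : Group H) (s₁ s₂ s₃ : H) (φ : G →* H),
      Subgroup.closure {s₁, s₂, s₃} = ⊤ ∧ Function.Injective φ ∧
        ∀ g ≠ 1, ∀ N : Subgroup H, N.Normal → φ g ∈ N → N = ⊤ := by
  obtain ⟨ν, hν⟩ := Countable.exists_injective_nat G
  obtain ⟨g₀, hg₀⟩ := exists_ne (1 : G)
  let I := {g : G // g ≠ 1} × Fin 4
  have : Nontrivial I := ⟨⟨(⟨g₀, hg₀⟩, 0), (⟨g₀, hg₀⟩, 1), fun h => by simpa using congrArg Prod.snd h⟩⟩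
  have hI {c : Fin 4 → ℤ} (hc : ∀ j k, c j ≡ c k [ZMOD 20] → j = k) :
      Function.Injective fun i : I => 20 * (ν i.1 : ℤ) + c i.2 := by
    rintro ⟨g, j⟩ ⟨g', k⟩ h
    dsimp only at h
    obtain rfl : j = k := hc j k (by unfold Int.ModEq; omega)
    have : g = g' := Subtype.ext (hν (by omega))
    rw [this]
  have hne {c d : Fin 4 → ℤ} (hcd : ∀ j k, ¬ c j ≡ d k [ZMOD 20]) (i i' : I) :
      20 * (ν i.1 : ℤ) + c i.2 ≠ 20 * (ν i'.1 : ℤ) + d i'.2 :=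
    fun h => hcd i.2 i'.2 (by unfold Int.ModEq; omega)
  let y : Coprod G (Multiplicative ℤ) := Coprod.inr (Multiplicative.ofAdd 1)
  let u : Coprod (Multiplicative ℤ) (Multiplicative ℤ) := Coprod.inr (Multiplicative.ofAdd 1)
  let v : Coprod (Multiplicative ℤ) (Multiplicative ℤ) := Coprod.inl (Multiplicative.ofAdd 1)
  let a : Fin 4 → ℤ := ![11, 12, 13, 15]
  let b : Fin 4 → ℤ := ![1, 2, 3, 4]
  let p : Fin 4 → ℤ := ![1, 3, 6, 10]
  let q : Fin 4 → ℤ := ![7, 8, 9, 11]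
  obtain ⟨P, _, α, β, hα, hαβ, htop⟩ := exists_amalgam _ _
    (injective_lift_coprod_int (fun i : I => (i.1 : G)) (fun i => i.1.2)
      _ _ (hI (c := a) (by decide)) (hI (c := b) (by decide)) (hne (by decide)))
    (injective_lift_coprod_int (fun i : I => Multiplicative.ofAdd (1 : ℤ))
      (fun i => by decide)
      _ _ (hI (c := p) (by decide)) (hI (c := q) (by decide)) (hne (by decide)))
  have hrel (g : G) (hg : g ≠ 1) (j : Fin 4) :
      α y ^ (20 * (ν g : ℤ) + a j) * α (Coprod.inl g) * α y ^ (-(20 * (ν g : ℤ) + b j)) =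
        β u ^ (20 * (ν g : ℤ) + p j) * β v * β u ^ (-(20 * (ν g : ℤ) + q j)) := by
    simpa only [FreeGroup.lift_apply_of, map_mul, map_zpow] using hαβ (FreeGroup.of (⟨g, hg⟩, j))
  have hgen (K : Subgroup P) (hy : α y ∈ K) (hu : β u ∈ K) (hv : β v ∈ K) : K = ⊤ := by
    rw [eq_top_iff, ← htop]
    refine sup_le (range_coprod_int_le α K (fun g => ?_) hy)
      (range_coprod_int_le β K (fun n => ?_) hu)
    · by_cases hg : g = 1
      · simp [hg, K.one_mem]
      · have hmem := K.mul_mem (K.mul_mem (K.zpow_mem hu (20 * (ν g : ℤ) + p 0)) hv)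
          (K.zpow_mem hu (-(20 * (ν g : ℤ) + q 0)))
        rwa [← hrel g hg 0, K.mul_mem_cancel_right (K.zpow_mem hy _),
          K.mul_mem_cancel_left (K.zpow_mem hy _)] at hmem
    · rw [eq_ofAdd_one_zpow n, map_zpow, map_zpow]
      exact K.zpow_mem hv _
  refine ⟨P, inferInstance, α y, β u, β v, α.comp Coprod.inl,
    hgen _ (Subgroup.subset_closure (by simp)) (Subgroup.subset_closure (by simp))
      (Subgroup.subset_closure (by simp)), hα.comp Coprod.inl_injective, fun g hg N hN hgN => ?_⟩
  have hq (j : Fin 4) : (α y : P ⧸ N) ^ (a j - b j) =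
      (β u : P ⧸ N) ^ (20 * (ν g : ℤ) + p j) * (β v : P ⧸ N) *
        (β u : P ⧸ N) ^ (-(20 * (ν g : ℤ) + q j)) := by
    have h := congrArg (QuotientGroup.mk' N) (hrel g hg j)
    have h1 : QuotientGroup.mk' N (α (Coprod.inl g)) = 1 := (QuotientGroup.eq_one_iff _).2 hgN
    simp only [map_mul, map_zpow, h1, mul_one, ← zpow_add] at h
    rw [show a j - b j = 20 * (ν g : ℤ) + a j + -(20 * (ν g : ℤ) + b j) by ring]
    exact h
  obtain ⟨hu, hv, hy⟩ := eq_one_of_twisted_relations (20 * (ν g : ℤ)) (hq 0) (hq 1) (hq 2) (hq 3)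
  exact hgen N ((QuotientGroup.eq_one_iff _).1 hy) ((QuotientGroup.eq_one_iff _).1 hu)
    ((QuotientGroup.eq_one_iff _).1 hv)

theorem exists_embedding_isSimpleGroup_of_nontrivial (G : Type) [Group G] [Countable G]
    [Nontrivial G] :
    ∃ (S : Type) (_ : Group S),
      IsSimpleGroup S ∧
      (∃ s₁ s₂ s₃ : S, Subgroup.closure {s₁, s₂, s₃} = ⊤) ∧
      ∃ φ : G →* S, Function.Injective φ := by
  obtain ⟨H, _, s₁, s₂, s₃, φ, hs, hφ, htop⟩ := exists_embedding_normally_generating G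
  obtain ⟨g₀, hg₀⟩ := exists_ne (1 : G)
  obtain ⟨N, hN, hgN, hsimple⟩ := exists_isSimpleGroup_quotient (φ g₀)
    ((map_ne_one_iff φ hφ).2 hg₀) (htop g₀ hg₀)
  refine ⟨H ⧸ N, inferInstance, hsimple, ⟨s₁, s₂, s₃, ?_⟩, (QuotientGroup.mk' N).comp φ, ?_⟩
  · have := congrArg (Subgroup.map (QuotientGroup.mk' N)) hs
    rw [MonoidHom.map_closure, Subgroup.map_top_of_surjective _ (QuotientGroup.mk'_surjective N)]
      at this
    simpa [Set.image_insert_eq] using this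
  · refine (injective_iff_map_eq_one _).2 fun g hg => ?_
    by_contra hne
    have hmem : φ g ∈ N := (QuotientGroup.eq_one_iff _).1 hg
    exact hgN (htop g hne N hN hmem ▸ Subgroup.mem_top _)

/-- P. Hall: every countable group embeds into a 3-generated simple group. -/
theorem hall_embedding_into_three_generated_simple_group
    (G : Type) [Group G] [Countable G] :
    ∃ (S : Type) (_ : Group S),
      IsSimpleGroup S ∧
      (∃ s₁ s₂ s₃ : S, Subgroup.closure {s₁, s₂, s₃} = ⊤) ∧
      ∃ φ : G →* S, Function.Injective φ := by
  obtain ⟨S, hS, hsimple, hgen, φ, hφ⟩ :=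
    exists_embedding_isSimpleGroup_of_nontrivial (G × Multiplicative (ZMod 2))
  exact ⟨S, hS, hsimple, hgen, φ.comp (MonoidHom.inl _ _), hφ.comp fun x y h => congrArg Prod.fst h⟩
end
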